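/- arXiv:2011.13661 — 2 statements merged into one kernel-verified Lean document; each statement's English description precedes it below -/
import Mathlib

section
/- Let τ > 0 and let p be a probability density on ℝ^d that is more log-concave than the Gaussian N(0, τ^{−1} I_d), with invertible covariance matrix A. Then for every integer q ≥ 3, T_p(A^{q−2}, I_d, I_d) ≤ (4/τ) · tr(A^q). -/
open MeasureTheory Filter Matrix

noncomputable section

/-- Mass of a set under a density. -/
def setMass {d : ℕ} (p : EuclideanSpace ℝ (Fin d) → ℝ) (S : Set (EuclideanSpace ℝ (Fin d))) : ℝ :=
  ∫ x in S, p x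

/-- `p` is a log-concave probability density on `ℝ^d`. -/
def IsLogConcaveDensity {d : ℕ} (p : EuclideanSpace ℝ (Fin d) → ℝ) : Prop :=
  (∀ x, 0 ≤ p x) ∧ (∫ x, p x = 1) ∧
    ∀ x y : EuclideanSpace ℝ (Fin d), ∀ t : ℝ, t ∈ Set.Icc (0:ℝ) 1 →
      p (t • x + (1 - t) • y) ≥ p x ^ t * p y ^ (1 - t)

/-- Boundary measure `p⁺(∂S)`. -/
def boundaryMeasure {d : ℕ} (p : EuclideanSpace ℝ (Fin d) → ℝ)
    (S : Set (EuclideanSpace ℝ (Fin d))) : ℝ :=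
  Filter.liminf
    (fun ε : ℝ => (setMass p {x | Metric.infDist x S ≤ ε} - setMass p S) / ε)
    (nhdsWithin 0 (Set.Ioi 0))

/-- Isoperimetric coefficient. -/
def isoperiCoeff {d : ℕ} (p : EuclideanSpace ℝ (Fin d) → ℝ) : ℝ :=
  sInf { r | ∃ S : Set (EuclideanSpace ℝ (Fin d)), MeasurableSet S ∧
    0 < setMass p S ∧ setMass p S < 1 ∧
    r = boundaryMeasure p S / min (setMass p S) (setMass p Sᶜ) }

/-- Mean of a density. -/
def densMean {d : ℕ} (p : EuclideanSpace ℝ (Fin d) → ℝ) : EuclideanSpace ℝ (Fin d) :=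
  ∫ x, p x • x

/-- Covariance matrix of a density. -/
def covMatrix {d : ℕ} (p : EuclideanSpace ℝ (Fin d) → ℝ) : Matrix (Fin d) (Fin d) ℝ :=
  Matrix.of fun i j => ∫ x, p x * ((x i - densMean p i) * (x j - densMean p j))

/-- Spectral norm of a matrix. -/
def specNorm {d : ℕ} (A : Matrix (Fin d) (Fin d) ℝ) : ℝ :=
  ‖Matrix.toEuclideanCLM (𝕜 := ℝ) A‖

/-- The KLS infimum constant over dimension `k`. -/
def psiDim (k : ℕ) : ℝ :=
  sInf { r | ∃ p : EuclideanSpace ℝ (Fin k) → ℝ, IsLogConcaveDensity p ∧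
    HasCompactSupport p ∧ r = isoperiCoeff p * Real.sqrt (specNorm (covMatrix p)) }

/-- Real power of a symmetric matrix through its spectral decomposition. -/
def matRpow {d : ℕ} (A : Matrix (Fin d) (Fin d) ℝ) (r : ℝ) : Matrix (Fin d) (Fin d) ℝ :=
  if hA : A.IsHermitian then
    (hA.eigenvectorUnitary : Matrix (Fin d) (Fin d) ℝ) *
      Matrix.diagonal (fun i => hA.eigenvalues i ^ r) *
      (star (hA.eigenvectorUnitary : Matrix (Fin d) (Fin d) ℝ))
  else 0

/-- The 3-tensor `T_p(A,B,C)` of a density. -/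
def ttensor {d : ℕ} (p : EuclideanSpace ℝ (Fin d) → ℝ)
    (A B C : Matrix (Fin d) (Fin d) ℝ) : ℝ :=
  ∫ x : EuclideanSpace ℝ (Fin d), ∫ y : EuclideanSpace ℝ (Fin d),
    p x * p y *
      (((fun i => x i - densMean p i) ⬝ᵥ A.mulVec (fun i => y i - densMean p i)) *
       ((fun i => x i - densMean p i) ⬝ᵥ B.mulVec (fun i => y i - densMean p i)) *
       ((fun i => x i - densMean p i) ⬝ᵥ C.mulVec (fun i => y i - densMean p i)))

/-- `p` is more log-concave than `N(0, τ⁻¹ I_d)`. -/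
def IsMoreLogConcaveThanGauss {d : ℕ} (τ : ℝ) (p : EuclideanSpace ℝ (Fin d) → ℝ) : Prop :=
  (∀ x, 0 ≤ p x) ∧ (∫ x, p x = 1) ∧
    ∀ x y : EuclideanSpace ℝ (Fin d), ∀ t : ℝ, t ∈ Set.Icc (0:ℝ) 1 →
      p (t • x + (1 - t) • y) * Real.exp (τ * ‖t • x + (1 - t) • y‖ ^ 2 / 2) ≥
        (p x * Real.exp (τ * ‖x‖ ^ 2 / 2)) ^ t *
        (p y * Real.exp (τ * ‖y‖ ^ 2 / 2)) ^ (1 - t)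

end

open scoped ENNReal

section PrekopaLeindler

/-- The one-dimensional Brunn–Minkowski inequality, for half-sums. -/
theorem volume_add_volume_le_two_mul_of_midpoint_mem {A B C : Set ℝ} (hA : MeasurableSet A)
    (hB : MeasurableSet B) (hA₀ : A.Nonempty) (hB₀ : B.Nonempty)
    (h : ∀ x ∈ A, ∀ y ∈ B, (2 : ℝ)⁻¹ • (x + y) ∈ C) :
    volume A + volume B ≤ 2 * volume C := by
  have compact_case : ∀ K ⊆ A, IsCompact K → ∀ L ⊆ B, IsCompact L → K.Nonempty → L.Nonempty →
      volume K + volume L ≤ 2 * volume C := by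
    intro K hKA hK L hLB hL hK₀ hL₀
    have hk := hK.sSup_mem hK₀
    have hl := hL.sInf_mem hL₀
    set k := sSup K
    set l := sInf L
    set c : ℝ := 2⁻¹ * (k + l)
    have image_volume : ∀ (z : ℝ) (S : Set ℝ),
        volume ((fun x => (2 : ℝ)⁻¹ * (x + z)) '' S) = 2⁻¹ * volume S := by
      intro z S
      have : (fun x => (2 : ℝ)⁻¹ * (x + z)) '' S
          = AffineMap.homothety z (2 : ℝ)⁻¹ '' S := by
        refine Set.image_congr fun x _ => ?_
        simp [AffineMap.homothety_apply]
        ring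
      rw [this, Measure.addHaar_image_homothety]
      simp [ENNReal.ofReal_inv_of_pos]
    have hlow : 2⁻¹ * volume K ≤ volume (C ∩ Set.Iic c) := by
      rw [← image_volume l K]
      refine measure_mono ?_
      rintro _ ⟨x, hx, rfl⟩
      refine ⟨by simpa using h x (hKA hx) l (hLB hl), ?_⟩
      have := le_csSup hK.bddAbove hx
      simp only [Set.mem_Iic, c]
      linarith
    have hhigh : 2⁻¹ * volume L ≤ volume (C \ Set.Iic c) := by
      rw [← image_volume k L, ← measure_sdiff_null (s := _ '' L) (Real.volume_singleton (a := c))]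
      refine measure_mono ?_
      rintro _ ⟨⟨y, hy, rfl⟩, hne⟩
      refine ⟨by simpa [add_comm] using h k (hKA hk) y (hLB hy), ?_⟩
      have := csInf_le hL.bddBelow hy
      simp only [Set.mem_Iic, not_le]
      refine lt_of_le_of_ne ?_ (Ne.symm hne)
      simp only [c]
      linarith
    have := add_le_add hlow hhigh
    rw [measure_inter_add_sdiff C measurableSet_Iic, ← mul_add] at this
    calc volume K + volume L = 2 * (2⁻¹ * (volume K + volume L)) := by
          rw [← mul_assoc, ENNReal.mul_inv_cancel (by simp) (by simp), one_mul]
      _ ≤ _ := by gcongr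
  obtain ⟨a, ha⟩ := hA₀
  obtain ⟨b, hb⟩ := hB₀
  rw [hA.measure_eq_iSup_isCompact, hB.measure_eq_iSup_isCompact]
  simp only [iSup_and']
  refine ENNReal.biSup_add_biSup_le' (p := fun K => K ⊆ A ∧ IsCompact K)
    (q := fun L => L ⊆ B ∧ IsCompact L) ⟨∅, by simp⟩ ⟨∅, by simp⟩ ?_
  intro K hK L hL
  refine le_trans (add_le_add (measure_mono (Set.subset_insert a K))
    (measure_mono (Set.subset_insert b L))) ?_
  exact compact_case _ (Set.insert_subset ha hK.1) (hK.2.insert a) _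
    (Set.insert_subset hb hL.1) (hL.2.insert b) (Set.insert_nonempty _ _) (Set.insert_nonempty _ _)

/-- The measure `μ` satisfies the Prékopa–Leindler inequality for half-sums. -/
def SatisfiesPrekopaLeindler {E : Type*} [AddCommGroup E] [Module ℝ E] [MeasurableSpace E]
    (μ : Measure E) : Prop :=
  ∀ f g h : E → ℝ≥0∞, Measurable f → Measurable g → Measurable h →
    (∀ x y, f x * g y ≤ h ((2 : ℝ)⁻¹ • (x + y)) ^ 2) →
    (∫⁻ x, f x ∂μ) * ∫⁻ x, g x ∂μ ≤ (∫⁻ x, h x ∂μ) ^ 2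

theorem lintegral_eq_lintegral_meas_lt_of_le_one {f : ℝ → ℝ≥0∞} (hf : Measurable f)
    (hf₁ : ∀ x, f x ≤ 1) :
    ∫⁻ x, f x = ∫⁻ t in Set.Ioi (0 : ℝ), volume {x | ENNReal.ofReal t < f x} := by
  have hfin : ∀ x, f x ≠ ∞ := fun x => ((hf₁ x).trans_lt ENNReal.one_lt_top).ne
  calc ∫⁻ x, f x = ∫⁻ x, ENNReal.ofReal (f x).toReal := by
        simp [ENNReal.ofReal_toReal (hfin _)]
    _ = ∫⁻ t in Set.Ioi (0 : ℝ), volume {x | t < (f x).toReal} :=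
        lintegral_eq_lintegral_meas_lt _ (ae_of_all _ fun x => ENNReal.toReal_nonneg)
          hf.ennreal_toReal.aemeasurable
    _ = _ := by
        refine setLIntegral_congr_fun measurableSet_Ioi fun t ht => ?_
        simp only [← ENNReal.ofReal_lt_iff_lt_toReal (le_of_lt ht) (hfin _)]

theorem lintegral_add_lintegral_le_of_iSup_eq_one {f g h : ℝ → ℝ≥0∞} (hf : Measurable f)
    (hg : Measurable g) (hh : Measurable h) (hf₁ : ⨆ x, f x = 1) (hg₁ : ⨆ x, g x = 1)
    (hfgh : ∀ x y, f x * g y ≤ h ((2 : ℝ)⁻¹ • (x + y)) ^ 2) :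
    (∫⁻ x, f x) + ∫⁻ x, g x ≤ 2 * ∫⁻ x, h x := by
  have hf_le : ∀ x, f x ≤ 1 := fun x => hf₁ ▸ le_iSup f x
  have hg_le : ∀ x, g x ≤ 1 := fun x => hg₁ ▸ le_iSup g x
  have hmin : ∫⁻ x, min (h x) 1 ≤ ∫⁻ x, h x := lintegral_mono fun x => min_le_left _ _
  refine le_trans ?_ (mul_le_mul_right hmin 2)
  rw [lintegral_eq_lintegral_meas_lt_of_le_one hf hf_le,
    lintegral_eq_lintegral_meas_lt_of_le_one hg hg_le,
    lintegral_eq_lintegral_meas_lt_of_le_one (hh.min measurable_const) (fun x => min_le_right _ _),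
    ← lintegral_const_mul' _ _ (by simp)]
  refine (le_lintegral_add _ _).trans (lintegral_mono fun t => ?_)
  rcases lt_or_ge (ENNReal.ofReal t) 1 with ht | ht
  · refine volume_add_volume_le_two_mul_of_midpoint_mem (measurableSet_lt measurable_const hf)
      (measurableSet_lt measurable_const hg) ?_ ?_ ?_
    · exact lt_iSup_iff.1 (hf₁ ▸ ht)
    · exact lt_iSup_iff.1 (hg₁ ▸ ht)
    · intro x hx y hy
      refine lt_min ?_ ht
      by_contra! hle
      have := (ENNReal.mul_lt_mul hx hy).trans_le ((hfgh x y).trans (pow_le_pow_left' hle 2))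
      rw [sq] at this
      exact lt_irrefl _ this
  · have hf_empty : {x | ENNReal.ofReal t < f x} = ∅ :=
      Set.eq_empty_of_forall_notMem fun x hx => absurd (hx.trans_le (hf_le x)) ht.not_gt
    have hg_empty : {x | ENNReal.ofReal t < g x} = ∅ :=
      Set.eq_empty_of_forall_notMem fun x hx => absurd (hx.trans_le (hg_le x)) ht.not_gt
    simp [hf_empty, hg_empty]

theorem lintegral_mul_lintegral_le_of_iSup_ne_top {f g h : ℝ → ℝ≥0∞} (hf : Measurable f)
    (hg : Measurable g) (hh : Measurable h) (hf₁ : ⨆ x, f x ≠ ∞) (hg₁ : ⨆ x, g x ≠ ∞)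
    (hfgh : ∀ x y, f x * g y ≤ h ((2 : ℝ)⁻¹ • (x + y)) ^ 2) :
    (∫⁻ x, f x) * ∫⁻ x, g x ≤ (∫⁻ x, h x) ^ 2 := by
  set a := ⨆ x, f x with ha
  set b := ⨆ x, g x with hb
  rcases eq_or_ne a 0 with ha₀ | ha₀
  · have : ∀ x, f x = 0 := by simpa [ha] using ha₀
    simp [this]
  rcases eq_or_ne b 0 with hb₀ | hb₀
  · have : ∀ x, g x = 0 := by simpa [hb] using hb₀
    simp [this]
  set c := (a * b) ^ (2⁻¹ : ℝ) with hc
  have hab : a * b ≠ ∞ := ENNReal.mul_ne_top hf₁ hg₁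
  have hab₀ : a * b ≠ 0 := mul_ne_zero ha₀ hb₀
  have hc_sq : c ^ 2 = a * b := by
    rw [hc, ← ENNReal.rpow_natCast, ← ENNReal.rpow_mul]
    simp
  have hc₀ : c ≠ 0 := by simp [hc, ENNReal.rpow_eq_zero_iff, hab₀, hab]
  have hc_top : c ≠ ∞ := by simp [hc, ENNReal.rpow_eq_top_iff, hab₀, hab]
  have key := lintegral_add_lintegral_le_of_iSup_eq_one (f := fun x => a⁻¹ * f x)
    (g := fun x => b⁻¹ * g x) (h := fun x => c⁻¹ * h x) (hf.const_mul _) (hg.const_mul _)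
    (hh.const_mul _) (by rw [← ENNReal.mul_iSup, ← ha, ENNReal.inv_mul_cancel ha₀ hf₁])
    (by rw [← ENNReal.mul_iSup, ← hb, ENNReal.inv_mul_cancel hb₀ hg₁]) (by
      intro x y
      calc a⁻¹ * f x * (b⁻¹ * g y) = (a⁻¹ * b⁻¹) * (f x * g y) := by ring
        _ ≤ (a⁻¹ * b⁻¹) * h ((2 : ℝ)⁻¹ • (x + y)) ^ 2 := by gcongr; exact hfgh x y
        _ = _ := by
          rw [mul_pow, ← ENNReal.inv_pow, hc_sq,
            ENNReal.mul_inv (Or.inl ha₀) (Or.inl hf₁)])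
  rw [lintegral_const_mul _ hf, lintegral_const_mul _ hg, lintegral_const_mul _ hh] at key
  set F := ∫⁻ x, f x
  set G := ∫⁻ x, g x
  set H := ∫⁻ x, h x
  have hfour : 4 * ((a⁻¹ * F) * (b⁻¹ * G)) ≤ 4 * (c⁻¹ * H) ^ 2 := by
    calc 4 * ((a⁻¹ * F) * (b⁻¹ * G)) ≤ (a⁻¹ * F + b⁻¹ * G) ^ 2 := by
          rw [← mul_assoc]
          rcases le_total (a⁻¹ * F) (b⁻¹ * G) with hle | hle <;>
            obtain ⟨r, hr⟩ := exists_add_of_le hle <;> rw [hr]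
          · calc 4 * (a⁻¹ * F) * (a⁻¹ * F + r)
                ≤ 4 * (a⁻¹ * F) * (a⁻¹ * F + r) + r ^ 2 := le_self_add
              _ = _ := by ring
          · calc 4 * (b⁻¹ * G + r) * (b⁻¹ * G)
                ≤ 4 * (b⁻¹ * G + r) * (b⁻¹ * G) + r ^ 2 := le_self_add
              _ = _ := by ring
      _ ≤ (2 * (c⁻¹ * H)) ^ 2 := by gcongr
      _ = _ := by ring
  rw [ENNReal.mul_le_mul_iff_right (by simp) (by simp)] at hfour
  calc F * G = (a * a⁻¹ * (b * b⁻¹)) * (F * G) := by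
        rw [ENNReal.mul_inv_cancel ha₀ hf₁, ENNReal.mul_inv_cancel hb₀ hg₁]; simp
    _ = a * b * ((a⁻¹ * F) * (b⁻¹ * G)) := by ring
    _ ≤ a * b * (c⁻¹ * H) ^ 2 := by gcongr
    _ = (c * c⁻¹) ^ 2 * H ^ 2 := by rw [← hc_sq]; ring
    _ = H ^ 2 := by rw [ENNReal.mul_inv_cancel hc₀ hc_top]; simp

theorem lintegral_eq_iSup_lintegral_min_natCast {f : ℝ → ℝ≥0∞} (hf : Measurable f) :
    ∫⁻ x, f x = ⨆ n : ℕ, ∫⁻ x, min (f x) n := by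
  rw [← lintegral_iSup (fun n => hf.min measurable_const)
    (fun m n hmn x => min_le_min le_rfl (by exact_mod_cast hmn))]
  refine lintegral_congr fun x => ?_
  rw [← inf_iSup_eq, ENNReal.iSup_natCast, inf_top_eq]

/-- Lebesgue measure on `ℝ` satisfies the Prékopa–Leindler inequality. -/
theorem satisfiesPrekopaLeindler_volume_real :
    SatisfiesPrekopaLeindler (volume : Measure ℝ) := by
  intro f g h hf hg hh hfgh
  rw [lintegral_eq_iSup_lintegral_min_natCast hf, lintegral_eq_iSup_lintegral_min_natCast hg,
    ENNReal.iSup_mul]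
  refine iSup_le fun n => ?_
  rw [ENNReal.mul_iSup]
  refine iSup_le fun m => ?_
  have iSup_min_ne_top : ∀ (u : ℝ → ℝ≥0∞) (k : ℕ), ⨆ x, min (u x) k ≠ ∞ := fun u k =>
    ((iSup_le fun x => min_le_right _ _).trans_lt (ENNReal.natCast_lt_top k)).ne
  refine lintegral_mul_lintegral_le_of_iSup_ne_top (hf.min measurable_const)
    (hg.min measurable_const) hh (iSup_min_ne_top f n) (iSup_min_ne_top g m) fun x y => ?_
  exact (mul_le_mul' (min_le_left _ _) (min_le_left _ _)).trans (hfgh x y)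

theorem SatisfiesPrekopaLeindler.prod {E F : Type*} [AddCommGroup E] [Module ℝ E]
    [MeasurableSpace E] [AddCommGroup F] [Module ℝ F] [MeasurableSpace F] {μ : Measure E}
    {ν : Measure F} [SFinite ν] (hμ : SatisfiesPrekopaLeindler μ)
    (hν : SatisfiesPrekopaLeindler ν) : SatisfiesPrekopaLeindler (μ.prod ν) := by
  intro f g h hf hg hh hfgh
  rw [lintegral_prod _ hf.aemeasurable, lintegral_prod _ hg.aemeasurable,
    lintegral_prod _ hh.aemeasurable]
  refine hμ _ _ _ hf.lintegral_prod_right' hg.lintegral_prod_right' hh.lintegral_prod_right'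
    fun s t => ?_
  refine hν (fun x => f (s, x)) (fun x => g (t, x)) (fun x => h ((2 : ℝ)⁻¹ • (s + t), x))
    (by fun_prop) (by fun_prop) (by fun_prop) fun x y => ?_
  simpa using hfgh (s, x) (t, y)

theorem SatisfiesPrekopaLeindler.of_measurePreserving {E F : Type*} [AddCommGroup E] [Module ℝ E]
    [MeasurableSpace E] [AddCommGroup F] [Module ℝ F] [MeasurableSpace F] {μ : Measure E}
    {ν : Measure F} (hμ : SatisfiesPrekopaLeindler μ) {e : E → F} (he : MeasurePreserving e μ ν)
    (hmid : ∀ x y, e ((2 : ℝ)⁻¹ • (x + y)) = (2 : ℝ)⁻¹ • (e x + e y)) :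
    SatisfiesPrekopaLeindler ν := by
  intro f g h hf hg hh hfgh
  rw [← he.lintegral_comp hf, ← he.lintegral_comp hg, ← he.lintegral_comp hh]
  refine hμ _ _ _ (hf.comp he.measurable) (hg.comp he.measurable) (hh.comp he.measurable)
    fun x y => ?_
  simpa only [Function.comp_apply, hmid] using hfgh (e x) (e y)

theorem satisfiesPrekopaLeindler_volume_pi (n : ℕ) :
    SatisfiesPrekopaLeindler (volume : Measure (Fin n → ℝ)) := by
  induction n with
  | zero =>
    intro f g h hf hg hh hfgh
    rw [Measure.volume_pi_eq_dirac 0, lintegral_dirac' _ hf,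
      lintegral_dirac' _ hg, lintegral_dirac' _ hh]
    simpa using hfgh 0 0
  | succ n ih =>
    refine (satisfiesPrekopaLeindler_volume_real.prod ih).of_measurePreserving
      (volume_preserving_piFinSuccAbove (fun _ : Fin (n + 1) => ℝ) 0).symm fun x y => ?_
    ext i
    refine Fin.cases ?_ (fun j => ?_) i <;>
      simp [MeasurableEquiv.piFinSuccAbove, Fin.insertNthEquiv, mul_add]

/-- The **Prékopa–Leindler inequality** on Euclidean space, for half-sums. -/
theorem satisfiesPrekopaLeindler_volume_euclideanSpace (d : ℕ) :
    SatisfiesPrekopaLeindler (volume : Measure (EuclideanSpace ℝ (Fin d))) :=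
  (satisfiesPrekopaLeindler_volume_pi d).of_measurePreserving (PiLp.volume_preserving_toLp (Fin d))
    fun _ _ => rfl

/-- The Prékopa–Leindler inequality with minimal measurability assumptions. -/
theorem SatisfiesPrekopaLeindler.lintegral_mul_lintegral_le {E : Type*} [AddCommGroup E]
    [Module ℝ E] [MeasurableSpace E] {μ : Measure E} (hμ : SatisfiesPrekopaLeindler μ)
    {f g h : E → ℝ≥0∞} (hh : AEMeasurable h μ)
    (hfgh : ∀ x y, f x * g y ≤ h ((2 : ℝ)⁻¹ • (x + y)) ^ 2) :
    (∫⁻ x, f x ∂μ) * ∫⁻ x, g x ∂μ ≤ (∫⁻ x, h x ∂μ) ^ 2 := by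
  obtain ⟨f', hf'm, hf'le, hf'⟩ := exists_measurable_le_lintegral_eq μ f
  obtain ⟨g', hg'm, hg'le, hg'⟩ := exists_measurable_le_lintegral_eq μ g
  classical
  set N := toMeasurable μ {x | h x ≠ hh.mk h x} with hN
  have hN₀ : μ N = 0 := by rw [hN, measure_toMeasurable]; exact hh.ae_eq_mk
  set h' : E → ℝ≥0∞ := N.piecewise (fun _ => ∞) (hh.mk h)
  have hle : ∀ x, h x ≤ h' x := by
    intro x
    by_cases hx : x ∈ N
    · simp [h', hx]
    · have : h x = hh.mk h x := by
        by_contra hne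
        exact hx (subset_toMeasurable _ _ hne)
      simp [h', hx, this]
  have hint : ∫⁻ x, h x ∂μ = ∫⁻ x, h' x ∂μ := by
    rw [lintegral_congr_ae hh.ae_eq_mk]
    refine lintegral_congr_ae ?_
    filter_upwards [compl_mem_ae_iff.2 hN₀] with x hx
    simp [h', Set.piecewise_eq_of_notMem _ _ _ hx]
  rw [hf', hg', hint]
  refine hμ f' g' h' hf'm hg'm
    (measurable_const.piecewise (measurableSet_toMeasurable _ _) hh.measurable_mk) fun x y => ?_
  exact (mul_le_mul' (hf'le x) (hg'le y)).trans ((hfgh x y).trans (pow_le_pow_left' (hle _) 2))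

end PrekopaLeindler

section PropertyTau

/-- Maurey's property (τ), for the quadratic cost `τ / 4 * ‖x - y‖ ^ 2`. -/
def HasPropertyTau {E : Type*} [NormedAddCommGroup E] [MeasurableSpace E] (τ : ℝ)
    (ν : Measure E) : Prop :=
  ∀ u v : E → ℝ, Measurable u → Measurable v → (∀ x y, u x + v y ≤ τ / 4 * ‖x - y‖ ^ 2) →
    (∫⁻ x, ENNReal.ofReal (Real.exp (u x)) ∂ν) * ∫⁻ x, ENNReal.ofReal (Real.exp (v x)) ∂ν ≤ 1

theorem add_sub_sq_half_sub_cube_le_exp (u : ℝ) : 1 + u + u ^ 2 / 2 - |u| ^ 3 ≤ Real.exp u := by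
  rcases le_total 0 u with hu | hu
  · have := Real.quadratic_le_exp_of_nonneg hu
    have : 0 ≤ |u| ^ 3 := by positivity
    linarith
  rcases le_total (-1) u with hu₁ | hu₁
  · have habs : |u| ≤ 1 := abs_le.2 ⟨hu₁, by linarith⟩
    have h := (abs_le.1 (Real.exp_bound habs (n := 3) (by norm_num))).1
    norm_num [Finset.sum_range_succ, Nat.factorial] at h
    have : 0 ≤ |u| ^ 3 := by positivity
    linarith
  · have := Real.exp_pos u
    rw [abs_of_nonpos hu]
    nlinarith [sq_nonneg u, mul_nonneg (sq_nonneg u) (by linarith : 0 ≤ -1 - u)]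

theorem one_add_pow_le_mul_exp_sq {c : ℝ} (hc : 0 < c) (k : ℕ) {r : ℝ} (hr : 0 ≤ r) :
    (1 + r) ^ k ≤ (k.factorial / c ^ k * Real.exp (2 * c)) * Real.exp (c * r ^ 2) := by
  have h := Real.pow_div_factorial_le_exp (c * (1 + r)) (by positivity) k
  have hexp : Real.exp (c * (1 + r)) ≤ Real.exp (2 * c) * Real.exp (c * r ^ 2) := by
    rw [← Real.exp_add]
    refine Real.exp_le_exp.2 ?_
    nlinarith [mul_nonneg hc.le (sq_nonneg (r - 1 / 2)), hc]
  rw [mul_pow, div_le_iff₀ (by positivity)] at h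
  calc (1 + r) ^ k = c ^ k * (1 + r) ^ k / c ^ k := by field_simp
    _ ≤ Real.exp (c * (1 + r)) * k.factorial / c ^ k := by gcongr
    _ ≤ (Real.exp (2 * c) * Real.exp (c * r ^ 2)) * k.factorial / c ^ k := by gcongr
    _ = _ := by ring

theorem nonpos_of_one_add_mul_one_add_le {α β C : ℝ}
    (h : ∀ᶠ ε in nhdsWithin (0 : ℝ) (Set.Ioi 0),
      (1 + ε ^ 2 * α - C * ε ^ 3) * (1 + ε ^ 2 * β - C * ε ^ 3) ≤ 1) :
    α + β ≤ 0 := by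
  have hcont : Continuous fun ε : ℝ =>
      (α - C * ε) + (β - C * ε) + ε ^ 2 * ((α - C * ε) * (β - C * ε)) := by fun_prop
  have hlim := (hcont.tendsto 0).mono_left (nhdsWithin_le_nhds (s := Set.Ioi 0))
  simp only [mul_zero, sub_zero, ne_eq, OfNat.ofNat_ne_zero, not_false_eq_true, zero_pow,
    zero_mul, add_zero] at hlim
  refine le_of_tendsto hlim ?_
  filter_upwards [h, self_mem_nhdsWithin] with ε hε hpos
  have hpos : 0 < ε := hpos
  refine nonpos_of_mul_nonpos_right (b := _) ?_ (pow_pos hpos 2)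
  nlinarith

theorem ofReal_integral_le_lintegral_of_le {α : Type*} [MeasurableSpace α] {μ : Measure α}
    {w g : α → ℝ} (hw : Integrable w μ) (hwg : ∀ x, w x ≤ g x) :
    ENNReal.ofReal (∫ x, w x ∂μ) ≤ ∫⁻ x, ENNReal.ofReal (g x) ∂μ := by
  refine le_trans ?_ (lintegral_mono fun x => ENNReal.ofReal_le_ofReal (hwg x))
  rw [integral_eq_lintegral_pos_part_sub_lintegral_neg_part hw]
  exact (ENNReal.ofReal_le_ofReal (sub_le_self _ ENNReal.toReal_nonneg)).trans
    ENNReal.ofReal_toReal_le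

namespace HasPropertyTau

variable {E : Type*} [NormedAddCommGroup E] [MeasurableSpace E] [BorelSpace E] {τ : ℝ}
  {ν : Measure E} [IsProbabilityMeasure ν]

theorem lintegral_exp_norm_sq_ne_top (h : HasPropertyTau τ ν) (hτ : 0 < τ) :
    ∫⁻ x, ENNReal.ofReal (Real.exp (τ / 8 * ‖x‖ ^ 2)) ∂ν ≠ ∞ := by
  have key := h (fun x => τ / 8 * ‖x‖ ^ 2) (fun y => -(τ / 4 * ‖y‖ ^ 2)) (by fun_prop)
    (by fun_prop) (by
      intro x y
      have h₁ : ‖x‖ ≤ ‖x - y‖ + ‖y‖ := by simpa using norm_add_le (x - y) y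
      have h₂ : ‖x‖ ^ 2 ≤ 2 * ‖x - y‖ ^ 2 + 2 * ‖y‖ ^ 2 := by
        nlinarith [norm_nonneg x, sq_nonneg (‖x - y‖ - ‖y‖), norm_nonneg (x - y), norm_nonneg y]
      nlinarith)
  intro htop
  have hpos : ∫⁻ y, ENNReal.ofReal (Real.exp (-(τ / 4 * ‖y‖ ^ 2))) ∂ν ≠ 0 := by
    intro hzero
    rw [lintegral_eq_zero_iff (by fun_prop)] at hzero
    obtain ⟨y, hy⟩ := hzero.exists
    simp [(Real.exp_pos _).not_ge] at hy
  rw [htop, ENNReal.top_mul hpos] at key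
  simp at key

variable [InnerProductSpace ℝ E]

theorem integrable_of_hasTemperateGrowth (h : HasPropertyTau τ ν) (hτ : 0 < τ) {F : Type*}
    [NormedAddCommGroup F] [NormedSpace ℝ F] [SecondCountableTopology F] {f : E → F}
    (hf : f.HasTemperateGrowth) : Integrable f ν := by
  borelize F
  obtain ⟨k, C, hC₀, hC⟩ := hf.norm_iteratedFDeriv_le_uniform 0
  have hexp : Integrable (fun x => Real.exp (τ / 8 * ‖x‖ ^ 2)) ν := by
    refine ⟨(by fun_prop : Measurable _).aestronglyMeasurable, ?_⟩
    rw [hasFiniteIntegral_iff_ofReal (ae_of_all _ fun x => (Real.exp_pos _).le)]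
    exact (h.lintegral_exp_norm_sq_ne_top hτ).lt_top
  refine (hexp.const_mul (C * (k.factorial / (τ / 8) ^ k * Real.exp (2 * (τ / 8))))).mono'
    hf.1.continuous.measurable.aestronglyMeasurable (ae_of_all _ fun x => ?_)
  have := hC 0 le_rfl x
  rw [norm_iteratedFDeriv_zero] at this
  refine this.trans ?_
  rw [mul_assoc]
  gcongr
  exact one_add_pow_le_mul_exp_sq (by positivity) k (norm_nonneg x)

/-- Linearization of property (τ) at second order. -/
theorem integral_sq_le (h : HasPropertyTau τ ν) (hτ : 0 < τ) {f b : E → ℝ}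
    (hf : f.HasTemperateGrowth) (hb : b.HasTemperateGrowth) (hf₀ : ∫ x, f x ∂ν = 0)
    (hfb : ∀ᶠ ε in nhdsWithin (0 : ℝ) (Set.Ioi 0), ∀ x y,
      ε * f x - ε ^ 2 * b x - ε * f y ≤ τ / 4 * ‖x - y‖ ^ 2) :
    ∫ x, f x ^ 2 ∂ν ≤ ∫ x, b x ∂ν := by
  have hfi := h.integrable_of_hasTemperateGrowth hτ hf
  have hbi := h.integrable_of_hasTemperateGrowth hτ hb
  have hf2i : Integrable (fun x => f x ^ 2) ν :=
    h.integrable_of_hasTemperateGrowth hτ (by fun_prop)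
  set S : E → ℝ := fun x => 1 + f x ^ 2 + b x ^ 2
  set W : E → ℝ := fun x => S x ^ 3 + S x
  have hWi : Integrable W ν := by
    refine h.integrable_of_hasTemperateGrowth hτ ?_
    simp only [W, S]
    fun_prop
  set C := ∫ x, W x ∂ν
  set X := ∫ x, f x ^ 2 ∂ν
  set G := ∫ x, b x ∂ν
  have hS : ∀ x, |f x| + |b x| ≤ S x := fun x => by
    simp only [S]
    rw [← sq_abs (f x), ← sq_abs (b x)]
    nlinarith [sq_nonneg (|f x| - 1 / 2), sq_nonneg (|b x| - 1 / 2)]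
  have lower : ∀ ε : ℝ, 0 < ε → ε ≤ 1 → ∀ x,
      1 + ε * f x + ε ^ 2 * (f x ^ 2 / 2 - b x) - ε ^ 3 * W x
        ≤ Real.exp (ε * f x - ε ^ 2 * b x) := by
    intro ε hε hε₁ x
    refine le_trans ?_ (add_sub_sq_half_sub_cube_le_exp _)
    have hS₀ : 0 ≤ S x := by simp only [S]; positivity
    have hs : |f x - ε * b x| ≤ S x := by
      refine (abs_sub _ _).trans (le_trans ?_ (hS x))
      rw [abs_mul, abs_of_pos hε]
      nlinarith [abs_nonneg (b x)]
    have hcube : |ε * f x - ε ^ 2 * b x| ^ 3 ≤ ε ^ 3 * S x ^ 3 := by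
      have : ε * f x - ε ^ 2 * b x = ε * (f x - ε * b x) := by ring
      rw [this, abs_mul, abs_of_pos hε, mul_pow]
      gcongr
    have hfb_le : f x * b x ≤ S x := by
      simp only [S]
      nlinarith [sq_nonneg (f x - b x), sq_nonneg (f x), sq_nonneg (b x)]
    have hlin : ε ^ 3 * (f x * b x) ≤ ε ^ 3 * S x := by gcongr
    simp only [W]
    nlinarith [sq_nonneg (ε ^ 2 * b x)]
  have lower' : ∀ ε : ℝ, 0 < ε → ε ≤ 1 → ∀ x,
      1 - ε * f x + ε ^ 2 * (f x ^ 2 / 2) - ε ^ 3 * W x ≤ Real.exp (-(ε * f x)) := by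
    intro ε hε hε₁ x
    refine le_trans ?_ (add_sub_sq_half_sub_cube_le_exp _)
    have hS₀ : 0 ≤ S x := by simp only [S]; positivity
    have hcube : |-(ε * f x)| ^ 3 ≤ ε ^ 3 * S x ^ 3 := by
      rw [abs_neg, abs_mul, abs_of_pos hε, mul_pow]
      gcongr
      linarith [hS x, abs_nonneg (b x)]
    simp only [W]
    nlinarith [mul_nonneg (pow_pos hε 3).le hS₀]
  suffices (X / 2 - G) + X / 2 ≤ 0 by linarith
  refine nonpos_of_one_add_mul_one_add_le (C := C) ?_
  have pos_eventually : ∀ α : ℝ, ∀ᶠ ε in nhdsWithin (0 : ℝ) (Set.Ioi 0),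
      0 < 1 + ε ^ 2 * α - C * ε ^ 3 := by
    intro α
    have hcont : Continuous fun ε : ℝ => 1 + ε ^ 2 * α - C * ε ^ 3 := by fun_prop
    refine nhdsWithin_le_nhds ((hcont.tendsto 0).eventually_const_lt ?_)
    norm_num
  have le_one : ∀ᶠ ε in nhdsWithin (0 : ℝ) (Set.Ioi 0), ε ≤ 1 :=
    nhdsWithin_le_nhds (Iic_mem_nhds one_pos)
  filter_upwards [hfb, pos_eventually (X / 2 - G), pos_eventually (X / 2), le_one,
    self_mem_nhdsWithin] with ε hε hpos₁ hpos₂ hε₁ hε₀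
  have hε₀ : 0 < ε := hε₀
  have key := h (fun x => ε * f x - ε ^ 2 * b x) (fun y => -(ε * f y))
    (by have := hf.1.continuous.measurable; have := hb.1.continuous.measurable; fun_prop)
    (by have := hf.1.continuous.measurable; fun_prop) (fun x y => by simpa using hε x y)
  have hint₁ : ∫ x, (1 + ε * f x + ε ^ 2 * (f x ^ 2 / 2 - b x) - ε ^ 3 * W x) ∂ν
      = 1 + ε ^ 2 * (X / 2 - G) - C * ε ^ 3 := by
    rw [integral_sub (by fun_prop) (by fun_prop), integral_add (by fun_prop) (by fun_prop),
      integral_add (by fun_prop) (by fun_prop), integral_const_mul, integral_const_mul,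
      integral_const_mul, integral_sub (by fun_prop) (by fun_prop), integral_div, hf₀]
    simp [C, X, G]
    ring
  have hint₂ : ∫ x, (1 - ε * f x + ε ^ 2 * (f x ^ 2 / 2) - ε ^ 3 * W x) ∂ν
      = 1 + ε ^ 2 * (X / 2) - C * ε ^ 3 := by
    rw [integral_sub (by fun_prop) (by fun_prop), integral_add (by fun_prop) (by fun_prop),
      integral_sub (by fun_prop) (by fun_prop), integral_const_mul, integral_const_mul,
      integral_const_mul, integral_div, hf₀]
    simp [C, X]
    ring
  have h₁ := ofReal_integral_le_lintegral_of_le (μ := ν) (by fun_prop) (lower ε hε₀ hε₁)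
  have h₂ := ofReal_integral_le_lintegral_of_le (μ := ν) (by fun_prop) (lower' ε hε₀ hε₁)
  rw [hint₁] at h₁
  rw [hint₂] at h₂
  have := (mul_le_mul' h₁ h₂).trans key
  rwa [← ENNReal.ofReal_mul hpos₁.le, ENNReal.ofReal_le_one] at this

/-- The Poincaré inequality with constant `τ⁻¹`, for quadratic functions. -/
theorem integral_sq_quadratic_sub_le (h : HasPropertyTau τ ν) (hτ : 0 < τ) (L : E →L[ℝ] E)
    (hL : ∀ x y, inner ℝ (L x) y = inner ℝ x (L y)) (z : E) :
    ∫ x, (inner ℝ (L (x - z)) (x - z) - ∫ y, inner ℝ (L (y - z)) (y - z) ∂ν) ^ 2 ∂ν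
      ≤ 4 / τ * ∫ x, ‖L (x - z)‖ ^ 2 ∂ν := by
  have hq : (fun x => inner ℝ (L (x - z)) (x - z)).HasTemperateGrowth :=
    (innerSL ℝ (E := E)).bilinear_hasTemperateGrowth (by fun_prop) (by fun_prop)
  have hn : (fun x => ‖L (x - z)‖ ^ 2).HasTemperateGrowth :=
    Function.HasTemperateGrowth.comp (f := fun x => L (x - z))
      (g := fun x : E => ‖x‖ ^ 2) (by fun_prop) (by fun_prop)
  set c := ∫ y, inner ℝ (L (y - z)) (y - z) ∂ν with hc
  have hG₀ : 0 ≤ ∫ x, ‖L (x - z)‖ ^ 2 ∂ν := integral_nonneg fun x => by positivity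
  have strict : ∀ a : ℝ, 4 / τ < a →
      ∫ x, (inner ℝ (L (x - z)) (x - z) - c) ^ 2 ∂ν ≤ a * ∫ x, ‖L (x - z)‖ ^ 2 ∂ν := by
    intro a ha
    have ha₀ : 0 < a := lt_trans (by positivity) ha
    rw [← integral_const_mul]
    refine h.integral_sq_le hτ (by fun_prop) (by fun_prop) ?_ ?_
    · rw [integral_sub (h.integrable_of_hasTemperateGrowth hτ hq) (by fun_prop)]
      simp [hc]
    have hgap : 0 < τ / 4 - 1 / a := by
      rw [sub_pos, div_lt_div_iff₀ ha₀ (by norm_num)]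
      rw [div_lt_iff₀ hτ] at ha
      linarith
    have hsmall : ∀ᶠ ε in nhdsWithin (0 : ℝ) (Set.Ioi 0), ε * ‖L‖ < τ / 4 - 1 / a := by
      have hcont : Continuous fun ε : ℝ => ε * ‖L‖ := by fun_prop
      refine nhdsWithin_le_nhds ((hcont.tendsto 0).eventually_lt_const ?_)
      simpa using hgap
    filter_upwards [hsmall, self_mem_nhdsWithin] with ε hε hε₀ x y
    have hε₀ : 0 < ε := hε₀
    set m := x - z
    set t := y - x
    have hy : y - z = m + t := by simp [m, t]
    have hexpand : inner ℝ (L (y - z)) (y - z)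
        = inner ℝ (L m) m + 2 * inner ℝ (L m) t + inner ℝ (L t) t := by
      rw [hy, map_add, inner_add_left, inner_add_right, inner_add_right, hL t m,
        real_inner_comm (L m) t]
      ring
    have h₁ : -(‖L m‖ * ‖t‖) ≤ inner ℝ (L m) t :=
      neg_le_of_abs_le (abs_real_inner_le_norm _ _)
    have h₂ : -(‖L‖ * ‖t‖ ^ 2) ≤ inner ℝ (L t) t := by
      have := neg_le_of_abs_le (abs_real_inner_le_norm (L t) t)
      nlinarith [L.le_opNorm t, norm_nonneg t]
    have h₃ : 2 * (ε * ‖L m‖ * ‖t‖) ≤ ε ^ 2 * (a * ‖L m‖ ^ 2) + 1 / a * ‖t‖ ^ 2 := by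
      have : 0 ≤ (ε * a * ‖L m‖ - ‖t‖) ^ 2 / a := by positivity
      have hexp : (ε * a * ‖L m‖ - ‖t‖) ^ 2 / a
          = ε ^ 2 * (a * ‖L m‖ ^ 2) + 1 / a * ‖t‖ ^ 2 - 2 * (ε * ‖L m‖ * ‖t‖) := by
        field_simp
        ring
      linarith
    have h₄ : ε * ‖L‖ * ‖t‖ ^ 2 ≤ (τ / 4 - 1 / a) * ‖t‖ ^ 2 := by gcongr
    rw [hexpand, norm_sub_rev x y]
    nlinarith [mul_le_mul_of_nonneg_left h₁ hε₀.le, mul_le_mul_of_nonneg_left h₂ hε₀.le]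
  refine le_of_forall_pos_le_add fun δ hδ => ?_
  have hden : 0 < (∫ x, ‖L (x - z)‖ ^ 2 ∂ν) + 1 := by linarith
  refine (strict (4 / τ + δ / ((∫ x, ‖L (x - z)‖ ^ 2 ∂ν) + 1))
    (by linarith [div_pos hδ hden])).trans ?_
  rw [add_mul]
  gcongr
  rw [div_mul_eq_mul_div, div_le_iff₀ hden]
  nlinarith

end HasPropertyTau

end PropertyTau

section StronglyLogConcave

variable {d : ℕ} {τ : ℝ} {p : EuclideanSpace ℝ (Fin d) → ℝ}

/-- The probability measure with a given density. -/
noncomputable def densityMeasure (p : EuclideanSpace ℝ (Fin d) → ℝ) :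
    Measure (EuclideanSpace ℝ (Fin d)) :=
  volume.withDensity fun x => ENNReal.ofReal (p x)

namespace IsMoreLogConcaveThanGauss

theorem nonneg (hp : IsMoreLogConcaveThanGauss τ p) (x : EuclideanSpace ℝ (Fin d)) : 0 ≤ p x :=
  hp.1 x

theorem integrable (hp : IsMoreLogConcaveThanGauss τ p) : Integrable p :=
  Integrable.of_integral_ne_zero (by rw [hp.2.1]; exact one_ne_zero)

theorem lintegral_ofReal_eq_one (hp : IsMoreLogConcaveThanGauss τ p) :
    ∫⁻ x, ENNReal.ofReal (p x) = 1 := by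
  rw [← ofReal_integral_eq_lintegral_ofReal hp.integrable (ae_of_all _ hp.nonneg), hp.2.1,
    ENNReal.ofReal_one]

theorem isProbabilityMeasure (hp : IsMoreLogConcaveThanGauss τ p) :
    IsProbabilityMeasure (densityMeasure p) :=
  ⟨by rw [densityMeasure, withDensity_apply _ MeasurableSet.univ, Measure.restrict_univ,
    hp.lintegral_ofReal_eq_one]⟩

theorem integral_densityMeasure (hp : IsMoreLogConcaveThanGauss τ p) {F : Type*}
    [NormedAddCommGroup F] [NormedSpace ℝ F] (f : EuclideanSpace ℝ (Fin d) → F) :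
    ∫ x, f x ∂densityMeasure p = ∫ x, p x • f x := by
  rw [densityMeasure, integral_withDensity_eq_integral_toReal_smul₀
    hp.integrable.aemeasurable.ennreal_ofReal (ae_of_all _ fun _ => ENNReal.ofReal_lt_top)]
  simp only [ENNReal.toReal_ofReal (hp.nonneg _)]

theorem mul_mul_exp_le_sq (hp : IsMoreLogConcaveThanGauss τ p)
    (x y : EuclideanSpace ℝ (Fin d)) :
    p x * p y * Real.exp (τ / 4 * ‖x - y‖ ^ 2) ≤ p ((2 : ℝ)⁻¹ • (x + y)) ^ 2 := by
  have h := hp.2.2 x y 2⁻¹ ⟨by norm_num, by norm_num⟩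
  have hhalf : (1 - 2⁻¹ : ℝ) = 2⁻¹ := by norm_num
  rw [hhalf, ← smul_add] at h
  set m := (2 : ℝ)⁻¹ • (x + y) with hm
  have hx := hp.nonneg x
  have hy := hp.nonneg y
  have rpow_half_sq : ∀ r : ℝ, 0 ≤ r → (r ^ (2⁻¹ : ℝ)) ^ 2 = r := fun r hr => by
    rw [← Real.rpow_natCast, ← Real.rpow_mul hr]
    norm_num
  have hsq := pow_le_pow_left₀ (by positivity) h 2
  rw [mul_pow, mul_pow, rpow_half_sq _ (by positivity), rpow_half_sq _ (by positivity)] at hsq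
  have hpar : ‖m‖ ^ 2 = (‖x‖ ^ 2 + ‖y‖ ^ 2) / 2 - ‖x - y‖ ^ 2 / 4 := by
    have := parallelogram_law_with_norm ℝ x y
    rw [hm, norm_smul, mul_pow]
    norm_num
    nlinarith
  have hexp : Real.exp (τ / 4 * ‖x - y‖ ^ 2) * Real.exp (τ * ‖m‖ ^ 2 / 2) ^ 2
      = Real.exp (τ * ‖x‖ ^ 2 / 2) * Real.exp (τ * ‖y‖ ^ 2 / 2) := by
    rw [← Real.exp_nat_mul, ← Real.exp_add, ← Real.exp_add, hpar]
    congr 1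
    push_cast
    ring
  refine le_of_mul_le_mul_right ?_ (pow_pos (Real.exp_pos (τ * ‖m‖ ^ 2 / 2)) 2)
  calc p x * p y * Real.exp (τ / 4 * ‖x - y‖ ^ 2) * Real.exp (τ * ‖m‖ ^ 2 / 2) ^ 2
      = p x * Real.exp (τ * ‖x‖ ^ 2 / 2) * (p y * Real.exp (τ * ‖y‖ ^ 2 / 2)) := by
        rw [mul_assoc (p x * p y), hexp]
        ring
    _ ≤ _ := hsq

theorem hasPropertyTau (hp : IsMoreLogConcaveThanGauss τ p) :
    HasPropertyTau τ (densityMeasure p) := by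
  intro u v hu hv huv
  have hpm : AEMeasurable (fun x => ENNReal.ofReal (p x)) volume :=
    hp.integrable.aemeasurable.ennreal_ofReal
  rw [densityMeasure, lintegral_withDensity_eq_lintegral_mul₀ hpm (by fun_prop),
    lintegral_withDensity_eq_lintegral_mul₀ hpm (by fun_prop)]
  refine ((satisfiesPrekopaLeindler_volume_euclideanSpace d).lintegral_mul_lintegral_le hpm
    fun x y => ?_).trans_eq (by rw [hp.lintegral_ofReal_eq_one, one_pow])
  have hx := hp.nonneg x
  have hy := hp.nonneg y
  simp only [Pi.mul_apply]
  rw [← ENNReal.ofReal_mul hx, ← ENNReal.ofReal_mul hy, ← ENNReal.ofReal_mul (by positivity),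
    ← ENNReal.ofReal_pow (hp.nonneg _)]
  refine ENNReal.ofReal_le_ofReal (le_trans ?_ (hp.mul_mul_exp_le_sq x y))
  calc p x * Real.exp (u x) * (p y * Real.exp (v y))
      = p x * p y * Real.exp (u x + v y) := by rw [Real.exp_add]; ring
    _ ≤ _ := by gcongr; exact huv x y

theorem integrable_densityMeasure (hp : IsMoreLogConcaveThanGauss τ p) (hτ : 0 < τ) {F : Type*}
    [NormedAddCommGroup F] [NormedSpace ℝ F] [SecondCountableTopology F]
    {f : EuclideanSpace ℝ (Fin d) → F} (hf : f.HasTemperateGrowth) :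
    Integrable f (densityMeasure p) :=
  have := hp.isProbabilityMeasure
  hp.hasPropertyTau.integrable_of_hasTemperateGrowth hτ hf

end IsMoreLogConcaveThanGauss

theorem pow_mul_add_pow_mul_le {x y : ℝ} (hx : 0 ≤ x) (hy : 0 ≤ y) (k : ℕ) :
    x ^ k * y + y ^ k * x ≤ x ^ (k + 1) + y ^ (k + 1) := by
  have : 0 ≤ (x ^ k - y ^ k) * (x - y) := by
    rcases le_total x y with h | h
    · exact mul_nonneg_of_nonpos_of_nonpos (sub_nonpos.2 (pow_le_pow_left₀ hx h k))
        (sub_nonpos.2 h)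
    · exact mul_nonneg (sub_nonneg.2 (pow_le_pow_left₀ hy h k)) (sub_nonneg.2 h)
  rw [pow_succ, pow_succ]
  linarith

theorem sum_pow_mul_sum_sq_le {ι : Type*} [Fintype ι] {l : ι → ℝ} (hl : ∀ a, 0 ≤ l a)
    {N : ι → ι → ι → ℝ} (hN : ∀ a b c, N a b c = N b a c) {κ : ℝ} (hκ₀ : 0 ≤ κ)
    (hκ : ∀ a, (∑ b, ∑ c, N a b c ^ 2) ^ 2 ≤ κ * l a * ∑ b, ∑ c, l b * N a b c ^ 2) (k : ℕ) :
    ∑ a, l a ^ (k + 1) * ∑ b, ∑ c, N a b c ^ 2 ≤ κ * ∑ a, l a ^ (k + 3) := by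
  set T : ι → ℝ := fun a => ∑ b, ∑ c, N a b c ^ 2 with hT
  set S : ι → ℝ := fun a => ∑ b, ∑ c, l b * N a b c ^ 2 with hS
  have hS₀ : ∀ a, 0 ≤ S a := fun a => Finset.sum_nonneg fun b _ =>
    Finset.sum_nonneg fun c _ => mul_nonneg (hl b) (sq_nonneg _)
  have hTS : ∀ a, l a ^ (k + 1) * T a ≤ (κ * l a ^ (k + 3) + l a ^ k * S a) / 2 := by
    intro a
    have hmean : l a * T a ≤ (κ * l a ^ 3 + S a) / 2 := by
      have hrhs : 0 ≤ (κ * l a ^ 3 + S a) / 2 := by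
        have := hS₀ a
        have := hl a
        positivity
      refine le_of_sq_le_sq ?_ hrhs
      calc (l a * T a) ^ 2 = l a ^ 2 * T a ^ 2 := by ring
        _ ≤ l a ^ 2 * (κ * l a * S a) := by gcongr; exact hκ a
        _ ≤ ((κ * l a ^ 3 + S a) / 2) ^ 2 := by nlinarith [sq_nonneg (κ * l a ^ 3 - S a)]
    calc l a ^ (k + 1) * T a = l a ^ k * (l a * T a) := by ring
      _ ≤ l a ^ k * ((κ * l a ^ 3 + S a) / 2) := by gcongr; exact pow_nonneg (hl a) k
      _ = _ := by ring
  have hsymm : ∑ a, l a ^ k * S a ≤ ∑ a, l a ^ (k + 1) * T a := by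
    have swap : ∀ w : ι → ι → ℝ, ∑ a, ∑ b, ∑ c, w a b * N a b c ^ 2
        = ∑ a, ∑ b, ∑ c, w b a * N a b c ^ 2 := by
      intro w
      rw [Finset.sum_comm]
      simp only [hN]
    have hleft : ∑ a, l a ^ k * S a = ∑ a, ∑ b, ∑ c, (l a ^ k * l b) * N a b c ^ 2 := by
      simp only [hS, Finset.mul_sum, mul_assoc]
    have hright : ∑ a, l a ^ (k + 1) * T a = ∑ a, ∑ b, ∑ c, l a ^ (k + 1) * N a b c ^ 2 := by
      simp only [hT, Finset.mul_sum]
    have hdouble : ∑ a, ∑ b, ∑ c, (l a ^ k * l b) * N a b c ^ 2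
        + ∑ a, ∑ b, ∑ c, (l b ^ k * l a) * N a b c ^ 2
        ≤ ∑ a, ∑ b, ∑ c, l a ^ (k + 1) * N a b c ^ 2
        + ∑ a, ∑ b, ∑ c, l b ^ (k + 1) * N a b c ^ 2 := by
      simp only [← Finset.sum_add_distrib, ← add_mul]
      refine Finset.sum_le_sum fun a _ => Finset.sum_le_sum fun b _ =>
        Finset.sum_le_sum fun c _ => ?_
      exact mul_le_mul_of_nonneg_right (pow_mul_add_pow_mul_le (hl a) (hl b) k) (sq_nonneg _)
    have h₁ := swap fun a b => l a ^ k * l b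
    have h₂ := swap fun a _ => l a ^ (k + 1)
    linarith
  have hsum := Finset.sum_le_sum fun a (_ : a ∈ Finset.univ) => hTS a
  rw [← Finset.sum_div, Finset.sum_add_distrib, ← Finset.mul_sum] at hsum
  linarith

theorem Matrix.IsHermitian.trace_pow_eq_sum_eigenvalues_pow {A : Matrix (Fin d) (Fin d) ℝ}
    (hA : A.IsHermitian) (k : ℕ) : (A ^ k).trace = ∑ a, hA.eigenvalues a ^ k := by
  conv_lhs => rw [hA.spectral_theorem, ← map_pow, Unitary.conjStarAlgAut_apply,
    Matrix.trace_mul_comm, ← mul_assoc]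
  simp [Matrix.diagonal_pow, Matrix.trace_diagonal]

theorem Matrix.IsHermitian.pow_mulVec_eigenvectorBasis {A : Matrix (Fin d) (Fin d) ℝ}
    (hA : A.IsHermitian) (k : ℕ) (a : Fin d) :
    (A ^ k) *ᵥ ⇑(hA.eigenvectorBasis a)
      = hA.eigenvalues a ^ k • ⇑(hA.eigenvectorBasis a) := by
  induction k with
  | zero => simp
  | succ k ih =>
    rw [pow_succ, ← Matrix.mulVec_mulVec, hA.mulVec_eigenvectorBasis, Matrix.mulVec_smul, ih,
      smul_smul, pow_succ']

theorem Matrix.IsHermitian.dotProduct_pow_mulVec {A : Matrix (Fin d) (Fin d) ℝ}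
    (hA : A.IsHermitian) (k : ℕ) (x y : EuclideanSpace ℝ (Fin d)) :
    ⇑x ⬝ᵥ (A ^ k) *ᵥ ⇑y = ∑ a, hA.eigenvalues a ^ k *
      (inner ℝ (hA.eigenvectorBasis a) x * inner ℝ (hA.eigenvectorBasis a) y) := by
  have hdot : ∀ u w : EuclideanSpace ℝ (Fin d), inner ℝ u w = ⇑u ⬝ᵥ ⇑w := fun u w => by
    rw [EuclideanSpace.inner_eq_star_dotProduct, dotProduct_comm]
    simp
  calc ⇑x ⬝ᵥ (A ^ k) *ᵥ ⇑y = inner ℝ x (WithLp.toLp 2 ((A ^ k) *ᵥ ⇑y)) := by rw [hdot]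
    _ = ∑ a, inner ℝ x (hA.eigenvectorBasis a) *
          inner ℝ (hA.eigenvectorBasis a) (WithLp.toLp 2 ((A ^ k) *ᵥ ⇑y)) :=
        (hA.eigenvectorBasis.sum_inner_mul_inner _ _).symm
    _ = _ := by
        refine Finset.sum_congr rfl fun a _ => ?_
        have : inner ℝ (hA.eigenvectorBasis a) (WithLp.toLp 2 ((A ^ k) *ᵥ ⇑y))
            = hA.eigenvalues a ^ k * inner ℝ (hA.eigenvectorBasis a) y := by
          have hsymm : (A ^ k)ᵀ = A ^ k := by
            have := (hA.pow k).eq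
            rwa [Matrix.conjTranspose_eq_transpose_of_trivial] at this
          rw [hdot, hdot, Matrix.dotProduct_mulVec, ← Matrix.mulVec_transpose, hsymm,
            hA.pow_mulVec_eigenvectorBasis, smul_dotProduct, smul_eq_mul]
        rw [this, real_inner_comm]
        ring

theorem isHermitian_covMatrix (p : EuclideanSpace ℝ (Fin d) → ℝ) :
    (covMatrix p).IsHermitian := by
  ext i j
  simp [covMatrix, mul_comm]

/-- The centered coordinate along the `a`-th eigenvector of the covariance matrix. -/
noncomputable def principalCoord (p : EuclideanSpace ℝ (Fin d) → ℝ) (a : Fin d)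
    (x : EuclideanSpace ℝ (Fin d)) : ℝ :=
  inner ℝ ((isHermitian_covMatrix p).eigenvectorBasis a) (x - densMean p)

@[fun_prop]
theorem hasTemperateGrowth_principalCoord (p : EuclideanSpace ℝ (Fin d) → ℝ) (a : Fin d) :
    (principalCoord p a).HasTemperateGrowth := by
  unfold principalCoord
  exact Function.HasTemperateGrowth.comp (f := fun x => x - densMean p)
    (g := fun x => inner ℝ ((isHermitian_covMatrix p).eigenvectorBasis a) x)
    (by fun_prop) (by fun_prop)

/-- The third central moments in principal coordinates. -/
noncomputable def principalThirdMoment (p : EuclideanSpace ℝ (Fin d) → ℝ) (a b c : Fin d) : ℝ :=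
  ∫ x, principalCoord p a x * principalCoord p b x * principalCoord p c x ∂densityMeasure p

namespace IsMoreLogConcaveThanGauss

theorem densMean_eq_integral (hp : IsMoreLogConcaveThanGauss τ p) :
    densMean p = ∫ x, x ∂densityMeasure p := by
  rw [hp.integral_densityMeasure, densMean]

theorem integral_principalCoord (hp : IsMoreLogConcaveThanGauss τ p) (hτ : 0 < τ) (a : Fin d) :
    ∫ x, principalCoord p a x ∂densityMeasure p = 0 := by
  have := hp.isProbabilityMeasure
  have hi : Integrable (fun x : EuclideanSpace ℝ (Fin d) => x) (densityMeasure p) :=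
    hp.integrable_densityMeasure hτ (by fun_prop)
  have h := integral_inner (𝕜 := ℝ) (f := fun x => x - densMean p) (hi.sub (integrable_const _))
    ((isHermitian_covMatrix p).eigenvectorBasis a)
  unfold principalCoord
  rw [h, integral_sub hi (integrable_const _), ← hp.densMean_eq_integral]
  simp

theorem integral_principalCoord_mul (hp : IsMoreLogConcaveThanGauss τ p) (hτ : 0 < τ)
    (a b : Fin d) :
    ∫ x, principalCoord p a x * principalCoord p b x ∂densityMeasure p
      = if a = b then (isHermitian_covMatrix p).eigenvalues a else 0 := by
  set hA := isHermitian_covMatrix p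
  set v := hA.eigenvectorBasis
  have hi : ∀ i j, Integrable (fun x : EuclideanSpace ℝ (Fin d) =>
      v a i * (v b j * ((x i - densMean p i) * (x j - densMean p j)))) (densityMeasure p) := by
    intro i j
    refine hp.integrable_densityMeasure hτ ?_
    have hc : ∀ i, (fun x : EuclideanSpace ℝ (Fin d) => x i).HasTemperateGrowth := fun i =>
      (EuclideanSpace.proj (𝕜 := ℝ) i).hasTemperateGrowth
    have := hc i
    have := hc j
    fun_prop
  have hexpand : ∀ x, principalCoord p a x * principalCoord p b x
      = ∑ i, ∑ j, v a i * (v b j * ((x i - densMean p i) * (x j - densMean p j))) := by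
    intro x
    simp only [principalCoord, PiLp.inner_apply, Finset.sum_mul_sum]
    refine Finset.sum_congr rfl fun i _ => Finset.sum_congr rfl fun j _ => ?_
    simp [v]
    ring
  have hquad : ⇑(v a) ⬝ᵥ covMatrix p *ᵥ ⇑(v b)
      = if a = b then hA.eigenvalues a else 0 := by
    rw [hA.mulVec_eigenvectorBasis, dotProduct_smul, dotProduct_comm]
    have := orthonormal_iff_ite.1 v.orthonormal a b
    rw [EuclideanSpace.inner_eq_star_dotProduct, star_trivial] at this
    rw [this]
    split_ifs with h <;> simp [h]
  rw [← hquad]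
  simp_rw [hexpand]
  rw [integral_finsetSum _ fun i _ => integrable_finsetSum _ fun j _ => hi i j]
  simp_rw [dotProduct, Matrix.mulVec, dotProduct, Finset.mul_sum]
  refine Finset.sum_congr rfl fun i _ => ?_
  rw [integral_finsetSum _ fun j _ => hi i j]
  refine Finset.sum_congr rfl fun j _ => ?_
  rw [integral_const_mul, integral_const_mul, hp.integral_densityMeasure]
  simp only [covMatrix, Matrix.of_apply, smul_eq_mul]
  ring

theorem ttensor_pow_one_one (hp : IsMoreLogConcaveThanGauss τ p) (hτ : 0 < τ) (k : ℕ) :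
    ttensor p (covMatrix p ^ k) 1 1 = ∑ a, (isHermitian_covMatrix p).eigenvalues a ^ k *
      ∑ b, ∑ c, principalThirdMoment p a b c ^ 2 := by
  set hA := isHermitian_covMatrix p
  have hi : ∀ a b c, Integrable (fun x => principalCoord p a x * principalCoord p b x *
      principalCoord p c x) (densityMeasure p) := fun a b c =>
    hp.integrable_densityMeasure hτ (by fun_prop)
  have hform : ∀ (j : ℕ) (x y : EuclideanSpace ℝ (Fin d)),
      (fun i => x i - densMean p i) ⬝ᵥ (covMatrix p ^ j).mulVec (fun i => y i - densMean p i)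
        = ∑ a, hA.eigenvalues a ^ j * (principalCoord p a x * principalCoord p a y) :=
    fun j x y => hA.dotProduct_pow_mulVec j (x - densMean p) (y - densMean p)
  have hone := hform 0
  simp only [pow_zero, one_mul] at hone
  have hexpand : ∀ x y : EuclideanSpace ℝ (Fin d), p x * p y *
      (((fun i => x i - densMean p i) ⬝ᵥ (covMatrix p ^ k).mulVec
          (fun i => y i - densMean p i)) *
       ((fun i => x i - densMean p i) ⬝ᵥ (1 : Matrix (Fin d) (Fin d) ℝ).mulVec
          (fun i => y i - densMean p i)) *
       ((fun i => x i - densMean p i) ⬝ᵥ (1 : Matrix (Fin d) (Fin d) ℝ).mulVec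
          (fun i => y i - densMean p i)))
      = p x * (p y • ∑ a, ∑ b, ∑ c, (hA.eigenvalues a ^ k * (principalCoord p a x *
          principalCoord p b x * principalCoord p c x)) *
          (principalCoord p a y * principalCoord p b y * principalCoord p c y)) := by
    intro x y
    rw [hform, hone, smul_eq_mul, mul_assoc (p x)]
    congr 2
    rw [mul_assoc, Finset.sum_mul_sum, Finset.sum_mul]
    refine Finset.sum_congr rfl fun a _ => ?_
    rw [Finset.mul_sum]
    refine Finset.sum_congr rfl fun b _ => ?_
    rw [Finset.mul_sum]
    refine Finset.sum_congr rfl fun c _ => ?_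
    ring
  simp only [ttensor, hexpand]
  simp_rw [integral_const_mul, ← hp.integral_densityMeasure, ← smul_eq_mul (p _),
    ← hp.integral_densityMeasure]
  have hinner : ∀ x, ∫ y, ∑ a, ∑ b, ∑ c, (hA.eigenvalues a ^ k * (principalCoord p a x *
      principalCoord p b x * principalCoord p c x)) *
      (principalCoord p a y * principalCoord p b y * principalCoord p c y) ∂densityMeasure p
      = ∑ a, ∑ b, ∑ c, (hA.eigenvalues a ^ k * principalThirdMoment p a b c) *
        (principalCoord p a x * principalCoord p b x * principalCoord p c x) := by
    intro x
    rw [integral_finsetSum _ fun a _ => integrable_finsetSum _ fun b _ =>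
      integrable_finsetSum _ fun c _ => (hi a b c).const_mul _]
    refine Finset.sum_congr rfl fun a _ => ?_
    rw [integral_finsetSum _ fun b _ => integrable_finsetSum _ fun c _ => (hi a b c).const_mul _]
    refine Finset.sum_congr rfl fun b _ => ?_
    rw [integral_finsetSum _ fun c _ => (hi a b c).const_mul _]
    refine Finset.sum_congr rfl fun c _ => ?_
    rw [integral_const_mul, ← principalThirdMoment]
    ring
  simp_rw [hinner, Finset.mul_sum]
  rw [integral_finsetSum _ fun a _ => integrable_finsetSum _ fun b _ =>
    integrable_finsetSum _ fun c _ => (hi a b c).const_mul _]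
  refine Finset.sum_congr rfl fun a _ => ?_
  rw [integral_finsetSum _ fun b _ => integrable_finsetSum _ fun c _ => (hi a b c).const_mul _]
  refine Finset.sum_congr rfl fun b _ => ?_
  rw [integral_finsetSum _ fun c _ => (hi a b c).const_mul _]
  refine Finset.sum_congr rfl fun c _ => ?_
  rw [integral_const_mul, ← principalThirdMoment]
  ring

theorem sq_sum_principalThirdMoment_sq_le (hp : IsMoreLogConcaveThanGauss τ p) (hτ : 0 < τ)
    (a : Fin d) :
    (∑ b, ∑ c, principalThirdMoment p a b c ^ 2) ^ 2
      ≤ 4 / τ * (isHermitian_covMatrix p).eigenvalues a *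
        ∑ b, ∑ c, (isHermitian_covMatrix p).eigenvalues b * principalThirdMoment p a b c ^ 2 := by
  have := hp.isProbabilityMeasure
  set hA := isHermitian_covMatrix p
  set v := hA.eigenvectorBasis with hv
  set N := principalThirdMoment p a with hN
  set n := principalCoord p with hn
  set ν := densityMeasure p with hν
  have hN_symm : ∀ b c, N b c = N c b := fun b c => by
    simp only [hN, principalThirdMoment]
    congr 1 with x
    ring
  set L : EuclideanSpace ℝ (Fin d) →L[ℝ] EuclideanSpace ℝ (Fin d) :=
    ∑ b, ∑ c, N b c • (innerSL ℝ (v b)).smulRight (v c) with hL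
  have hL_apply : ∀ x, L x = ∑ c, (∑ b, N b c * inner ℝ (v b) x) • v c := by
    intro x
    simp only [hL, _root_.sum_apply, _root_.smul_apply,
      ContinuousLinearMap.smulRight_apply, innerSL_apply_apply, smul_smul, Finset.sum_smul]
    rw [Finset.sum_comm]
  have hL_inner : ∀ x y, inner ℝ (L x) y
      = ∑ b, ∑ c, N b c * (inner ℝ (v b) x * inner ℝ (v c) y) := by
    intro x y
    rw [hL_apply, sum_inner, Finset.sum_comm]
    refine Finset.sum_congr rfl fun c _ => ?_
    rw [real_inner_smul_left, Finset.sum_mul]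
    exact Finset.sum_congr rfl fun b _ => by ring
  have hL_symm : ∀ x y, inner ℝ (L x) y = inner ℝ x (L y) := by
    intro x y
    rw [real_inner_comm (L y) x, hL_inner, hL_inner, Finset.sum_comm]
    refine Finset.sum_congr rfl fun b _ => Finset.sum_congr rfl fun c _ => ?_
    rw [hN_symm]
    ring
  have hquad : ∀ x, inner ℝ (L (x - densMean p)) (x - densMean p)
      = ∑ b, ∑ c, N b c * (n b x * n c x) := fun x => hL_inner _ _
  have hnorm : ∀ x, ‖L (x - densMean p)‖ ^ 2
      = ∑ c, ∑ b, ∑ b', (N b c * N b' c) * (n b x * n b' x) := by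
    intro x
    rw [hL_apply, ← real_inner_self_eq_norm_sq, v.orthonormal.inner_sum]
    refine Finset.sum_congr rfl fun c _ => ?_
    simp only [conj_trivial, Finset.sum_mul_sum]
    refine Finset.sum_congr rfl fun b _ => Finset.sum_congr rfl fun b' _ => ?_
    simp only [hn, principalCoord, hv]
    ring
  have hpoincare := hp.hasPropertyTau.integral_sq_quadratic_sub_le hτ L hL_symm (densMean p)
  simp only [hquad, hnorm] at hpoincare
  have hi₂ : ∀ b c, Integrable (fun x => n b x * n c x) ν := fun b c =>
    hp.integrable_densityMeasure hτ (by fun_prop)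
  have hi₃ : ∀ b c, Integrable (fun x => n a x * n b x * n c x) ν := fun b c =>
    hp.integrable_densityMeasure hτ (by fun_prop)
  have hgrad : ∫ x, ∑ c, ∑ b, ∑ b', (N b c * N b' c) * (n b x * n b' x) ∂ν
      = ∑ b, ∑ c, hA.eigenvalues b * N b c ^ 2 := by
    rw [integral_finsetSum _ fun c _ => integrable_finsetSum _ fun b _ =>
      integrable_finsetSum _ fun b' _ => (hi₂ b b').const_mul _, Finset.sum_comm]
    refine Finset.sum_congr rfl fun c _ => ?_
    rw [integral_finsetSum _ fun b _ => integrable_finsetSum _ fun b' _ =>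
      (hi₂ b b').const_mul _]
    refine Finset.sum_congr rfl fun b _ => ?_
    rw [integral_finsetSum _ fun b' _ => (hi₂ b b').const_mul _]
    simp only [integral_const_mul, hn, hν, hp.integral_principalCoord_mul hτ]
    simp
    ring
  rw [hgrad] at hpoincare
  set Q : EuclideanSpace ℝ (Fin d) → ℝ := fun x => ∑ b, ∑ c, N b c * (n b x * n c x) with hQ
  set m := ∫ x, Q x ∂ν
  have hQg : Q.HasTemperateGrowth := by
    refine Function.HasTemperateGrowth.sum fun b _ => Function.HasTemperateGrowth.sum fun c _ => ?_
    fun_prop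
  have hcov : ∫ x, n a x * (Q x - m) ∂ν = ∑ b, ∑ c, N b c ^ 2 := by
    have hsub : ∀ x, n a x * (Q x - m)
        = (∑ b, ∑ c, N b c * (n a x * n b x * n c x)) - n a x * m := by
      intro x
      rw [mul_sub, hQ, Finset.mul_sum]
      congr 1
      refine Finset.sum_congr rfl fun b _ => ?_
      rw [Finset.mul_sum]
      exact Finset.sum_congr rfl fun c _ => by ring
    simp_rw [hsub]
    rw [integral_sub (integrable_finsetSum _ fun b _ => integrable_finsetSum _ fun c _ =>
        (hi₃ b c).const_mul _) (hp.integrable_densityMeasure hτ (by fun_prop)),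
      integral_mul_const, hp.integral_principalCoord hτ, zero_mul, sub_zero,
      integral_finsetSum _ fun b _ => integrable_finsetSum _ fun c _ => (hi₃ b c).const_mul _]
    refine Finset.sum_congr rfl fun b _ => ?_
    rw [integral_finsetSum _ fun c _ => (hi₃ b c).const_mul _]
    refine Finset.sum_congr rfl fun c _ => ?_
    rw [integral_const_mul, sq]
    rfl
  have hvar : ∫ x, n a x ^ 2 ∂ν = hA.eigenvalues a := by
    have := hp.integral_principalCoord_mul hτ a a
    simpa [sq] using this
  have hQ₀ : 0 ≤ ∫ x, (Q x - m) ^ 2 ∂ν := integral_nonneg fun x => sq_nonneg _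
  have hcs : (∫ x, n a x * (Q x - m) ∂ν) ^ 2
      ≤ (∫ x, n a x ^ 2 ∂ν) * ∫ x, (Q x - m) ^ 2 ∂ν := by
    have hquadratic : ∀ t : ℝ, 0 ≤ (∫ x, n a x ^ 2 ∂ν) * (t * t)
        + (2 * ∫ x, n a x * (Q x - m) ∂ν) * t + ∫ x, (Q x - m) ^ 2 ∂ν := by
      intro t
      have hnonneg : 0 ≤ ∫ x, (t * n a x + (Q x - m)) ^ 2 ∂ν :=
        integral_nonneg fun x => sq_nonneg _
      have hexp : ∀ x, (t * n a x + (Q x - m)) ^ 2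
          = t * t * n a x ^ 2 + 2 * t * (n a x * (Q x - m)) + (Q x - m) ^ 2 := fun x => by ring
      have h₁ : Integrable (fun x => n a x ^ 2) ν :=
        hp.integrable_densityMeasure hτ (by fun_prop)
      have h₂ : Integrable (fun x => n a x * (Q x - m)) ν :=
        hp.integrable_densityMeasure hτ (by fun_prop)
      have h₃ : Integrable (fun x => (Q x - m) ^ 2) ν :=
        hp.integrable_densityMeasure hτ (by fun_prop)
      simp_rw [hexp] at hnonneg
      rw [integral_add (by fun_prop) h₃, integral_add (by fun_prop) (by fun_prop),
        integral_const_mul, integral_const_mul] at hnonneg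
      linarith
    have := discrim_le_zero hquadratic
    rw [discrim] at this
    nlinarith
  rw [hcov, hvar] at hcs
  have hl : 0 ≤ hA.eigenvalues a := by rw [← hvar]; exact integral_nonneg fun x => sq_nonneg _
  calc (∑ b, ∑ c, N b c ^ 2) ^ 2 ≤ hA.eigenvalues a * ∫ x, (Q x - m) ^ 2 ∂ν := hcs
    _ ≤ hA.eigenvalues a * (4 / τ * ∑ b, ∑ c, hA.eigenvalues b * N b c ^ 2) := by gcongr
    _ = _ := by ring

theorem eigenvalues_covMatrix_nonneg (hp : IsMoreLogConcaveThanGauss τ p) (hτ : 0 < τ)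
    (a : Fin d) : 0 ≤ (isHermitian_covMatrix p).eigenvalues a := by
  have h := hp.integral_principalCoord_mul hτ a a
  rw [if_pos rfl] at h
  rw [← h]
  exact integral_nonneg fun x => mul_self_nonneg _

end IsMoreLogConcaveThanGauss

end StronglyLogConcave

/-- Lemma: 3-tensor bound for strongly log-concave densities. -/
theorem ttensor_oneoverT_bound {d : ℕ} (τ : ℝ) (hτ : 0 < τ)
    (p : EuclideanSpace ℝ (Fin d) → ℝ) (hp : IsMoreLogConcaveThanGauss τ p)
    (hdet : IsUnit (covMatrix p).det) (q : ℕ) (hq : 3 ≤ q) :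
    ttensor p (covMatrix p ^ (q - 2)) 1 1 ≤ (4 / τ) * Matrix.trace (covMatrix p ^ q) := by
  obtain ⟨k, rfl⟩ := Nat.exists_eq_add_of_le' hq
  rw [show k + 3 - 2 = k + 1 by omega, hp.ttensor_pow_one_one hτ,
    (isHermitian_covMatrix p).trace_pow_eq_sum_eigenvalues_pow]
  refine sum_pow_mul_sum_sq_le (hp.eigenvalues_covMatrix_nonneg hτ) (fun a b c => ?_)
    (by positivity) (hp.sq_sum_principalThirdMoment_sq_le hτ) k
  simp only [principalThirdMoment, mul_comm (principalCoord p a _)]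
end

section
/- Let p be a log-concave probability density on ℝ^d, let δ ∈ [0,1], and let A, B, C be positive semi-definite d×d real matrices. Then T_p( B^{1/2} A^{δ} B^{1/2}, B^{1/2} A^{1−δ} B^{1/2}, C ) ≤ T_p( B^{1/2} A B^{1/2}, B, C ). -/
open MeasureTheory Filter Matrix

theorem exists_setIntegral_compl_closedBall_lt {E : Type*} [NormedAddCommGroup E]
    [MeasurableSpace E] [BorelSpace E] {ν : Measure E} {f : E → ℝ} (hf : Integrable f ν)
    {ε : ℝ} (hε : 0 < ε) : ∃ n : ℕ, ∫ x in (Metric.closedBall (0 : E) n)ᶜ, f x ∂ν < ε := by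
  have h := tendsto_setIntegral_of_antitone (μ := ν) (f := f)
    (s := fun n : ℕ => (Metric.closedBall (0 : E) n)ᶜ)
    (fun _ => Metric.isClosed_closedBall.measurableSet.compl)
    (fun m n hmn => Set.compl_subset_compl.2
      (Metric.closedBall_subset_closedBall (by exact_mod_cast hmn)))
    ⟨0, hf.integrableOn⟩
  have hempty : ⋂ n : ℕ, (Metric.closedBall (0 : E) n)ᶜ = ∅ := by
    rw [← Set.compl_iUnion, Metric.iUnion_closedBall_nat, Set.compl_univ]
  rw [hempty, setIntegral_empty] at h
  exact (h.eventually_lt_const hε).exists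

namespace IsLogConcaveDensity

variable {d : ℕ} {p : EuclideanSpace ℝ (Fin d) → ℝ}

theorem integrable (hp : IsLogConcaveDensity p) : Integrable p := by
  by_contra h
  simpa [integral_undef h] using hp.2.1

theorem exists_pos (hp : IsLogConcaveDensity p) : ∃ x, 0 < p x := by
  by_contra! h
  have h0 : p = 0 := funext fun x => le_antisymm (h x) (hp.1 x)
  simpa [h0] using hp.2.1

theorem sqrt_mul_sqrt_le (hp : IsLogConcaveDensity p) (x y : EuclideanSpace ℝ (Fin d)) :
    √(p x) * √(p y) ≤ p ((1 / 2 : ℝ) • x + (1 / 2 : ℝ) • y) := by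
  have h := hp.2.2 x y (1 / 2) (by norm_num)
  rw [show (1 : ℝ) - 1 / 2 = 1 / 2 by norm_num] at h
  simpa only [Real.sqrt_eq_rpow] using h

theorem integrable_sqrt (hp : IsLogConcaveDensity p) : Integrable fun x => √(p x) := by
  obtain ⟨x₀, hx₀⟩ := hp.exists_pos
  have h : Integrable fun x => p ((1 / 2 : ℝ) • x + (1 / 2 : ℝ) • x₀) / √(p x₀) :=
    ((hp.integrable.comp_add_right ((1 / 2 : ℝ) • x₀)).comp_smul
      (R := 1 / 2) (by norm_num)).div_const _
  refine h.mono' (Real.continuous_sqrt.comp_aestronglyMeasurable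
    hp.integrable.aestronglyMeasurable) (ae_of_all _ fun x => ?_)
  rw [Real.norm_of_nonneg (Real.sqrt_nonneg _), le_div_iff₀ (Real.sqrt_pos.2 hx₀)]
  exact hp.sqrt_mul_sqrt_le x x₀

theorem integral_sqrt_pos (hp : IsLogConcaveDensity p) : 0 < ∫ x, √(p x) := by
  refine lt_of_le_of_ne (integral_nonneg fun x => Real.sqrt_nonneg _) fun h => ?_
  have h0 := (integral_eq_zero_iff_of_nonneg (fun x => Real.sqrt_nonneg _)
    hp.integrable_sqrt).1 h.symm
  have h1 : p =ᵐ[volume] 0 := by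
    filter_upwards [h0] with x hx
    exact (Real.sqrt_eq_zero (hp.1 x)).1 hx
  simpa [integral_congr_ae h1] using hp.2.1

/-- A log-concave density vanishes at infinity. -/
theorem exists_forall_le_of_le_norm (hp : IsLogConcaveDensity p) {ε : ℝ} (hε : 0 < ε) :
    ∃ R : ℝ, 0 < R ∧ ∀ x, R ≤ ‖x‖ → p x ≤ ε := by
  obtain ⟨n, hn⟩ := exists_setIntegral_compl_closedBall_lt hp.integrable_sqrt hp.integral_sqrt_pos
  have hB : MeasurableSet (Metric.closedBall (0 : EuclideanSpace ℝ (Fin d)) n) :=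
    Metric.isClosed_closedBall.measurableSet
  set I := ∫ x in Metric.closedBall (0 : EuclideanSpace ℝ (Fin d)) n, √(p x) with hI
  have hIpos : 0 < I := by
    have := integral_add_compl hB hp.integrable_sqrt
    linarith
  set c : ℝ := |((1 / 2 : ℝ) ^ Module.finrank ℝ (EuclideanSpace ℝ (Fin d)))⁻¹| with hc
  have hcpos : 0 < c := by positivity
  obtain ⟨m, hm⟩ := exists_setIntegral_compl_closedBall_lt hp.integrable
    (show 0 < √ε * I / c by positivity)
  have hm' : MeasurableSet (Metric.closedBall (0 : EuclideanSpace ℝ (Fin d)) m)ᶜ :=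
    Metric.isClosed_closedBall.measurableSet.compl
  refine ⟨2 * m + n + 1, by positivity, fun x hx => ?_⟩
  set g := (Metric.closedBall (0 : EuclideanSpace ℝ (Fin d)) m)ᶜ.indicator p with hg
  have hgi : Integrable g := hp.integrable.indicator hm'
  have hint : ∫ z, g ((1 / 2 : ℝ) • z + (1 / 2 : ℝ) • x) =
      c * ∫ z in (Metric.closedBall (0 : EuclideanSpace ℝ (Fin d)) m)ᶜ, p z := by
    rw [Measure.integral_comp_smul volume (fun w => g (w + (1 / 2 : ℝ) • x)),
      integral_add_right_eq_self g, hg, integral_indicator hm', smul_eq_mul]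
  have hle : I * √(p x) ≤ ∫ z, g ((1 / 2 : ℝ) • z + (1 / 2 : ℝ) • x) := by
    rw [hI, ← integral_indicator hB, ← integral_mul_const]
    refine integral_mono ((hp.integrable_sqrt.indicator hB).mul_const _)
      ((hgi.comp_add_right ((1 / 2 : ℝ) • x)).comp_smul (R := 1 / 2) (by norm_num))
      fun z => ?_
    by_cases hz : z ∈ Metric.closedBall (0 : EuclideanSpace ℝ (Fin d)) n
    · have hmem : (1 / 2 : ℝ) • z + (1 / 2 : ℝ) • x ∈
          (Metric.closedBall (0 : EuclideanSpace ℝ (Fin d)) m)ᶜ := by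
        rw [Set.mem_compl_iff, mem_closedBall_zero_iff, not_le, ← smul_add, norm_smul]
        rw [mem_closedBall_zero_iff] at hz
        have := norm_sub_le (z + x) z
        rw [add_sub_cancel_left] at this
        norm_num
        linarith
      simp only [hg, Set.indicator_of_mem hz, Set.indicator_of_mem hmem]
      exact hp.sqrt_mul_sqrt_le z x
    · simp only [Set.indicator_of_notMem hz, zero_mul]
      exact Set.indicator_nonneg (fun w _ => hp.1 w) _
  rw [hint] at hle
  rw [lt_div_iff₀ hcpos] at hm
  have hlt : √(p x) * I < √ε * I := by linarith
  exact ((Real.sqrt_lt_sqrt_iff (hp.1 x)).1 (lt_of_mul_lt_mul_right hlt hIpos.le)).le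

/-- A log-concave density decays exponentially. -/
theorem exists_forall_le_exp (hp : IsLogConcaveDensity p) :
    ∃ a b R : ℝ, 0 < a ∧ 0 < b ∧ 0 < R ∧
      ∀ x, R ≤ ‖x‖ → p x ≤ a * Real.exp (-(b * (1 + ‖x‖))) := by
  obtain ⟨x₀, hx₀⟩ := hp.exists_pos
  obtain ⟨R, hR, h⟩ := hp.exists_forall_le_of_le_norm
    (show 0 < p x₀ * Real.exp (-1) by positivity)
  set S := R + ‖x₀‖ with hS
  have hSpos : 0 < S := by positivity
  have hdecay : ∀ x, S ≤ ‖x - x₀‖ → p x ≤ p x₀ * Real.exp (-(‖x - x₀‖ / S)) := by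
    intro x hx
    have hxpos : 0 < ‖x - x₀‖ := hSpos.trans_le hx
    set t := S / ‖x - x₀‖ with ht
    have htpos : 0 < t := by positivity
    have ht1 : t ≤ 1 := (div_le_one hxpos).2 hx
    have hlc := hp.2.2 x x₀ t ⟨htpos.le, ht1⟩
    have hfar : R ≤ ‖t • x + (1 - t) • x₀‖ := by
      have h1 : t • x + (1 - t) • x₀ - x₀ = t • (x - x₀) := by module
      have h2 : ‖t • (x - x₀)‖ = S := by
        rw [norm_smul, Real.norm_of_nonneg htpos.le, ht, div_mul_cancel₀ _ hxpos.ne']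
      have h3 := norm_sub_le (t • x + (1 - t) • x₀) x₀
      rw [h1, h2] at h3
      linarith
    have hsmall := hlc.le.trans (h _ hfar)
    have hexp : Real.exp (-(‖x - x₀‖ / S)) ^ t = Real.exp (-1) := by
      rw [← Real.exp_mul, ht]
      congr 1
      field_simp
    rw [← Real.rpow_le_rpow_iff (hp.1 x) (by positivity) htpos,
      Real.mul_rpow hx₀.le (Real.exp_pos _).le, hexp]
    have hsplit : p x₀ = p x₀ ^ t * p x₀ ^ (1 - t) := by
      rw [← Real.rpow_add hx₀, add_sub_cancel, Real.rpow_one]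
    have hpos : 0 < p x₀ ^ (1 - t) := Real.rpow_pos_of_pos hx₀ _
    refine le_of_mul_le_mul_right ?_ hpos
    calc p x ^ t * p x₀ ^ (1 - t) ≤ p x₀ * Real.exp (-1) := hsmall
      _ = p x₀ ^ t * p x₀ ^ (1 - t) * Real.exp (-1) := by rw [← hsplit]
      _ = p x₀ ^ t * Real.exp (-1) * p x₀ ^ (1 - t) := by ring
  refine ⟨p x₀, 1 / (4 * S), 2 * S + 2 * ‖x₀‖ + 1, hx₀, by positivity, by positivity,
    fun x hx => ?_⟩
  have hn := norm_sub_norm_le x x₀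
  have hx₀n := norm_nonneg x₀
  refine (hdecay x (by linarith)).trans ?_
  gcongr
  rw [one_div, inv_mul_eq_div, div_le_div_iff₀ (by positivity) hSpos]
  nlinarith

/-- A log-concave density has finite absolute moments of every order. -/
theorem integrable_one_add_norm_pow_mul (hp : IsLogConcaveDensity p) (k : ℕ) :
    Integrable fun x => (1 + ‖x‖) ^ k * p x := by
  obtain ⟨a, b, R, ha, hb, hR, h⟩ := hp.exists_forall_le_exp
  set c : ℝ := a * ((k + (d + 1)).factorial / b ^ (k + (d + 1))) with hc
  have hg : Integrable fun x : EuclideanSpace ℝ (Fin d) =>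
      (1 + R) ^ k * p x + c * (1 + ‖x‖) ^ (-((d + 1 : ℕ) : ℝ)) := by
    refine (hp.integrable.const_mul _).add ((integrable_one_add_norm ?_).const_mul _)
    simp
  refine hg.mono' (AEStronglyMeasurable.mul (by fun_prop) hp.integrable.aestronglyMeasurable)
    (ae_of_all _ fun x => ?_)
  have hx1 : 0 < 1 + ‖x‖ := by positivity
  have hpx := hp.1 x
  have hcpos : 0 ≤ c := by positivity
  rw [Real.norm_of_nonneg (by positivity)]
  rcases le_total ‖x‖ R with hx | hx
  · have h1 : (1 + ‖x‖) ^ k * p x ≤ (1 + R) ^ k * p x := by gcongr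
    have h2 : 0 ≤ c * (1 + ‖x‖) ^ (-((d + 1 : ℕ) : ℝ)) := by positivity
    linarith
  · have h1 : 0 ≤ (1 + R) ^ k * p x := by positivity
    have h2 : (1 + ‖x‖) ^ k * p x ≤ c * (1 + ‖x‖) ^ (-((d + 1 : ℕ) : ℝ)) := by
      have he := Real.pow_div_factorial_le_exp (b * (1 + ‖x‖)) (by positivity) (k + (d + 1))
      have he' : Real.exp (-(b * (1 + ‖x‖))) ≤
          (k + (d + 1)).factorial / (b * (1 + ‖x‖)) ^ (k + (d + 1)) := by
        rw [Real.exp_neg, ← inv_div]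
        exact inv_anti₀ (by positivity) he
      calc (1 + ‖x‖) ^ k * p x
          ≤ (1 + ‖x‖) ^ k *
            (a * ((k + (d + 1)).factorial / (b * (1 + ‖x‖)) ^ (k + (d + 1)))) := by
            gcongr
            exact (h x hx).trans (by gcongr)
        _ = c * (1 + ‖x‖) ^ (-((d + 1 : ℕ) : ℝ)) := by
            rw [Real.rpow_neg hx1.le, Real.rpow_natCast, hc, mul_pow, pow_add (1 + ‖x‖)]
            field_simp
    linarith

end IsLogConcaveDensity

/-- The third central moment of a density in the directions `u`, `v`, `w`. -/
noncomputable def thirdMoment {d : ℕ} (p : EuclideanSpace ℝ (Fin d) → ℝ) (u v w : Fin d → ℝ) : ℝ :=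
  ∫ x : EuclideanSpace ℝ (Fin d), p x *
    ((u ⬝ᵥ fun i => x i - densMean p i) * (v ⬝ᵥ fun i => x i - densMean p i) *
      (w ⬝ᵥ fun i => x i - densMean p i))

theorem thirdMoment_swap {d : ℕ} (p : EuclideanSpace ℝ (Fin d) → ℝ) (u v w : Fin d → ℝ) :
    thirdMoment p v u w = thirdMoment p u v w := by
  simp only [thirdMoment, mul_comm (v ⬝ᵥ _)]

theorem exists_abs_dotProduct_sub_le {d : ℕ} (u μ : Fin d → ℝ) :
    ∃ K : ℝ, 0 ≤ K ∧ ∀ x : EuclideanSpace ℝ (Fin d),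
      |u ⬝ᵥ fun i => x i - μ i| ≤ K * (1 + ‖x‖) := by
  refine ⟨∑ i, |u i| * (1 + |μ i|), by positivity, fun x => ?_⟩
  rw [dotProduct, Finset.sum_mul]
  refine (Finset.abs_sum_le_sum_abs _ _).trans (Finset.sum_le_sum fun i _ => ?_)
  rw [abs_mul, mul_assoc]
  gcongr
  have h1 : |x i| ≤ ‖x‖ := PiLp.norm_apply_le x i
  have h2 : |x i - μ i| ≤ |x i| + |μ i| := abs_sub _ _
  nlinarith [mul_nonneg (abs_nonneg (μ i)) (norm_nonneg x)]

theorem IsLogConcaveDensity.integrable_thirdMoment {d : ℕ} {p : EuclideanSpace ℝ (Fin d) → ℝ}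
    (hp : IsLogConcaveDensity p) (μ u v w : Fin d → ℝ) :
    Integrable fun x : EuclideanSpace ℝ (Fin d) => p x *
      ((u ⬝ᵥ fun i => x i - μ i) * (v ⬝ᵥ fun i => x i - μ i) *
        (w ⬝ᵥ fun i => x i - μ i)) := by
  obtain ⟨K, hK, hu⟩ := exists_abs_dotProduct_sub_le u μ
  obtain ⟨L, hL, hv⟩ := exists_abs_dotProduct_sub_le v μ
  obtain ⟨M, hM, hw⟩ := exists_abs_dotProduct_sub_le w μ
  refine ((hp.integrable_one_add_norm_pow_mul 3).const_mul (K * L * M)).mono'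
    (hp.integrable.aestronglyMeasurable.mul (Continuous.aestronglyMeasurable ?_))
    (ae_of_all _ fun x => ?_)
  · simp only [dotProduct]
    fun_prop
  · rw [Real.norm_eq_abs, abs_mul, abs_mul, abs_mul, abs_of_nonneg (hp.1 x)]
    have hpx := hp.1 x
    calc _ ≤ p x * ((K * (1 + ‖x‖)) * (L * (1 + ‖x‖)) * (M * (1 + ‖x‖))) := by
          gcongr
          exacts [hu x, hv x, hw x]
      _ = _ := by ring

theorem dotProduct_mul_diagonal_mul_transpose_mulVec {m n R : Type*} [Fintype m] [Fintype n]
    [DecidableEq n] [CommRing R] (U : Matrix m n R) (α : n → R) (x y : m → R) :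
    x ⬝ᵥ (U * diagonal α * Uᵀ) *ᵥ y = ∑ a, α a * ((U.col a ⬝ᵥ x) * (U.col a ⬝ᵥ y)) := by
  rw [← mulVec_mulVec, ← mulVec_mulVec, dotProduct_mulVec, dotProduct]
  refine Finset.sum_congr rfl fun a _ => ?_
  rw [mulVec_diagonal, ← mulVec_transpose]
  change (U.col a ⬝ᵥ x) * (α a * (U.col a ⬝ᵥ y)) = _
  ring

/-- The 3-tensor of three diagonalized forms as a combination of squared third moments. -/
theorem ttensor_mul_diagonal_mul_transpose {d : ℕ} {p : EuclideanSpace ℝ (Fin d) → ℝ}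
    (hp : IsLogConcaveDensity p) (U V W : Matrix (Fin d) (Fin d) ℝ) (α β γ : Fin d → ℝ) :
    ttensor p (U * diagonal α * Uᵀ) (V * diagonal β * Vᵀ) (W * diagonal γ * Wᵀ) =
      ∑ a, ∑ b, ∑ c, α a * β b * γ c * thirdMoment p (U.col a) (V.col b) (W.col c) ^ 2 := by
  set F : Fin d → Fin d → Fin d → EuclideanSpace ℝ (Fin d) → ℝ := fun a b c x => p x *
    ((U.col a ⬝ᵥ fun i => x i - densMean p i) * (V.col b ⬝ᵥ fun i => x i - densMean p i) *
      (W.col c ⬝ᵥ fun i => x i - densMean p i)) with hF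
  have hFi : ∀ a b c, Integrable (F a b c) := fun a b c =>
    hp.integrable_thirdMoment (densMean p) (U.col a) (V.col b) (W.col c)
  have hpt : ∀ x y : EuclideanSpace ℝ (Fin d), p x * p y *
      (((fun i => x i - densMean p i) ⬝ᵥ
          (U * diagonal α * Uᵀ).mulVec (fun i => y i - densMean p i)) *
       ((fun i => x i - densMean p i) ⬝ᵥ
          (V * diagonal β * Vᵀ).mulVec (fun i => y i - densMean p i)) *
       ((fun i => x i - densMean p i) ⬝ᵥ
          (W * diagonal γ * Wᵀ).mulVec (fun i => y i - densMean p i))) =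
      ∑ a, ∑ b, ∑ c, α a * β b * γ c * F a b c x * F a b c y := by
    intro x y
    simp only [dotProduct_mul_diagonal_mul_transpose_mulVec]
    rw [Finset.sum_mul_sum, Finset.sum_mul, Finset.mul_sum]
    refine Finset.sum_congr rfl fun a _ => ?_
    rw [Finset.sum_mul, Finset.mul_sum]
    refine Finset.sum_congr rfl fun b _ => ?_
    rw [Finset.mul_sum, Finset.mul_sum]
    refine Finset.sum_congr rfl fun c _ => ?_
    simp only [hF]
    ring
  have hinner : ∀ x, ∫ y, ∑ a, ∑ b, ∑ c, α a * β b * γ c * F a b c x * F a b c y =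
      ∑ a, ∑ b, ∑ c, α a * β b * γ c * F a b c x * ∫ y, F a b c y := by
    intro x
    have h := fun a b c => (hFi a b c).const_mul (α a * β b * γ c * F a b c x)
    rw [integral_finsetSum _ fun a _ => integrable_finsetSum _ fun b _ =>
      integrable_finsetSum _ fun c _ => h a b c]
    refine Finset.sum_congr rfl fun a _ => ?_
    rw [integral_finsetSum _ fun b _ => integrable_finsetSum _ fun c _ => h a b c]
    refine Finset.sum_congr rfl fun b _ => ?_
    rw [integral_finsetSum _ fun c _ => h a b c]
    exact Finset.sum_congr rfl fun c _ => integral_const_mul _ _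
  have h := fun a b c =>
    ((hFi a b c).const_mul (α a * β b * γ c)).mul_const (∫ y, F a b c y)
  simp only [ttensor, hpt, hinner]
  rw [integral_finsetSum _ fun a _ => integrable_finsetSum _ fun b _ =>
    integrable_finsetSum _ fun c _ => h a b c]
  refine Finset.sum_congr rfl fun a _ => ?_
  rw [integral_finsetSum _ fun b _ => integrable_finsetSum _ fun c _ => h a b c]
  refine Finset.sum_congr rfl fun b _ => ?_
  rw [integral_finsetSum _ fun c _ => h a b c]
  refine Finset.sum_congr rfl fun c _ => ?_
  rw [integral_mul_const, integral_const_mul, mul_assoc, sq]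
  rfl

theorem matRpow_eq {d : ℕ} {A : Matrix (Fin d) (Fin d) ℝ} (hA : A.IsHermitian) (r : ℝ) :
    matRpow A r = (hA.eigenvectorUnitary : Matrix (Fin d) (Fin d) ℝ) *
      diagonal (fun i => hA.eigenvalues i ^ r) *
      (hA.eigenvectorUnitary : Matrix (Fin d) (Fin d) ℝ)ᵀ := by
  rw [matRpow, dif_pos hA, star_eq_conjTranspose, conjTranspose_eq_transpose_of_trivial]

theorem matRpow_one {d : ℕ} {A : Matrix (Fin d) (Fin d) ℝ} (hA : A.IsHermitian) :
    matRpow A 1 = A := by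
  conv_rhs => rw [hA.spectral_theorem, Unitary.conjStarAlgAut_apply]
  rw [matRpow, dif_pos hA]
  congr 3
  ext i
  simp

theorem matRpow_mul_matRpow {d : ℕ} {A : Matrix (Fin d) (Fin d) ℝ} (hA : A.PosSemidef)
    {r s : ℝ} (hr : 0 ≤ r) (hs : 0 ≤ s) : matRpow A r * matRpow A s = matRpow A (r + s) := by
  simp only [matRpow, dif_pos hA.isHermitian]
  set U := hA.isHermitian.eigenvectorUnitary
  have hU : star (U : Matrix (Fin d) (Fin d) ℝ) * U = 1 := Unitary.coe_star_mul_self U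
  calc _ = (U : Matrix (Fin d) (Fin d) ℝ) *
        diagonal (fun i => hA.isHermitian.eigenvalues i ^ r) *
        (star (U : Matrix (Fin d) (Fin d) ℝ) * U) *
        diagonal (fun i => hA.isHermitian.eigenvalues i ^ s) *
        star (U : Matrix (Fin d) (Fin d) ℝ) := by simp only [Matrix.mul_assoc]
    _ = _ := by
      rw [hU, Matrix.mul_one, Matrix.mul_assoc (U : Matrix (Fin d) (Fin d) ℝ), diagonal_mul_diagonal]
      simp only [← Real.rpow_add_of_nonneg (hA.eigenvalues_nonneg _) hr hs]

theorem transpose_matRpow {d : ℕ} (A : Matrix (Fin d) (Fin d) ℝ) (r : ℝ) :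
    (matRpow A r)ᵀ = matRpow A r := by
  by_cases hA : A.IsHermitian
  · simp [matRpow_eq hA, Matrix.mul_assoc]
  · rw [matRpow, dif_neg hA, transpose_zero]

theorem rpow_mul_rpow_add_swap_le {a b t : ℝ} (ha : 0 ≤ a) (hb : 0 ≤ b)
    (ht : t ∈ Set.Icc (0 : ℝ) 1) : a ^ t * b ^ (1 - t) + b ^ t * a ^ (1 - t) ≤ a + b := by
  have h1 := Real.geom_mean_le_arith_mean2_weighted ht.1 (sub_nonneg.2 ht.2) ha hb (by ring)
  have h2 := Real.geom_mean_le_arith_mean2_weighted ht.1 (sub_nonneg.2 ht.2) hb ha (by ring)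
  linarith

theorem sum_rpow_mul_rpow_mul_le {ι : Type*} [Fintype ι] {a : ι → ℝ} (ha : ∀ i, 0 ≤ a i)
    {g : ι → ι → ℝ} (hg : ∀ i j, 0 ≤ g i j) (hsymm : ∀ i j, g i j = g j i)
    {t : ℝ} (ht : t ∈ Set.Icc (0 : ℝ) 1) :
    ∑ i, ∑ j, a i ^ t * a j ^ (1 - t) * g i j ≤ ∑ i, ∑ j, a i * g i j := by
  have hswap : ∀ f : ι → ι → ℝ, ∑ i, ∑ j, f j i * g i j = ∑ i, ∑ j, f i j * g i j := by
    intro f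
    rw [Finset.sum_comm]
    simp only [hsymm]
  have hL := hswap fun i j => a i ^ t * a j ^ (1 - t)
  have hR := hswap fun i _ => a i
  have hsum : ∑ i, ∑ j, (a i ^ t * a j ^ (1 - t) * g i j + a j ^ t * a i ^ (1 - t) * g i j) ≤
      ∑ i, ∑ j, (a i * g i j + a j * g i j) := by
    refine Finset.sum_le_sum fun i _ => Finset.sum_le_sum fun j _ => ?_
    rw [← add_mul, ← add_mul]
    exact mul_le_mul_of_nonneg_right (rpow_mul_rpow_add_swap_le (ha i) (ha j) ht) (hg i j)
  simp only [Finset.sum_add_distrib] at hsum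
  linarith

/-- Lemma: 3-tensor swap inequality. -/
theorem ttensor_swap {d : ℕ} (p : EuclideanSpace ℝ (Fin d) → ℝ)
    (hp : IsLogConcaveDensity p) (δ : ℝ) (hδ : δ ∈ Set.Icc (0 : ℝ) 1)
    (A B C : Matrix (Fin d) (Fin d) ℝ)
    (hA : A.PosSemidef) (hB : B.PosSemidef) (hC : C.PosSemidef) :
    ttensor p (matRpow B ((1 : ℝ) / 2) * matRpow A δ * matRpow B ((1 : ℝ) / 2))
        (matRpow B ((1 : ℝ) / 2) * matRpow A (1 - δ) * matRpow B ((1 : ℝ) / 2)) C ≤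
      ttensor p (matRpow B ((1 : ℝ) / 2) * A * matRpow B ((1 : ℝ) / 2)) B C := by
  have hAh := hA.isHermitian
  have hCh := hC.isHermitian
  set M := matRpow B ((1 : ℝ) / 2) with hM
  have hMt : Mᵀ = M := transpose_matRpow B _
  set U := (hAh.eigenvectorUnitary : Matrix (Fin d) (Fin d) ℝ) with hU
  have hUU : U * Uᵀ = 1 := by
    rw [← conjTranspose_eq_transpose_of_trivial, ← star_eq_conjTranspose]
    exact Unitary.coe_mul_star_self hAh.eigenvectorUnitary
  have hconj : ∀ r, M * matRpow A r * M =
      (M * U) * diagonal (fun i => hAh.eigenvalues i ^ r) * (M * U)ᵀ := by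
    intro r
    rw [matRpow_eq hAh, transpose_mul, hMt]
    simp only [Matrix.mul_assoc, ← hU]
  have hMAM : M * A * M = (M * U) * diagonal hAh.eigenvalues * (M * U)ᵀ := by
    simpa only [matRpow_one hAh, Real.rpow_one] using hconj 1
  have hBeq : B = (M * U) * diagonal (fun _ => (1 : ℝ)) * (M * U)ᵀ := by
    rw [diagonal_one, Matrix.mul_one, transpose_mul, hMt, Matrix.mul_assoc, ← Matrix.mul_assoc U,
      hUU, Matrix.one_mul, hM, matRpow_mul_matRpow hB (by norm_num) (by norm_num), add_halves,
      matRpow_one hB.isHermitian]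
  have hCeq := (matRpow_one hCh).symm.trans (matRpow_eq hCh 1)
  have hR : ttensor p (M * A * M) B C = _ :=
    (congrArg₂ (fun X Y => ttensor p (M * A * M) X Y) hBeq hCeq).trans
      ((congrArg (fun X => ttensor p X _ _) hMAM).trans
        (ttensor_mul_diagonal_mul_transpose hp _ _ _ _ _ _))
  have hL := (congrArg (ttensor p (M * matRpow A δ * M) (M * matRpow A (1 - δ) * M)) hCeq).trans
    (((congrArg₂ (fun X Y => ttensor p X Y _) (hconj δ) (hconj (1 - δ)))).trans
      (ttensor_mul_diagonal_mul_transpose hp _ _ _ _ _ _))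
  rw [hL, hR]
  have hmain := sum_rpow_mul_rpow_mul_le (a := hAh.eigenvalues) hA.eigenvalues_nonneg
    (g := fun a b => ∑ c, hCh.eigenvalues c ^ (1 : ℝ) * thirdMoment p ((M * U).col a) ((M * U).col b)
      ((hCh.eigenvectorUnitary : Matrix (Fin d) (Fin d) ℝ).col c) ^ 2)
    (fun a b => Finset.sum_nonneg fun c _ =>
      mul_nonneg (Real.rpow_nonneg (hC.eigenvalues_nonneg c) _) (sq_nonneg _))
    (fun a b => Finset.sum_congr rfl fun c _ => by rw [thirdMoment_swap]) hδ
  simpa only [Finset.mul_sum, mul_one, mul_assoc] using hmain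
end
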